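/- arXiv:1302.3822 — 2 statements merged into one kernel-verified Lean document; each statement's English description precedes it below -/
import Mathlib

section
/- Let K be a field of arbitrary characteristic and let C be an affine line arrangement in V = K² whose characteristic polynomial factors as χ(C,t) = (t − a)(t − a − b) with a, b ∈ ℤ_{≥0} and a ≤ a + b. If there exists a line H in V (belonging to C or not) such that |C ∩ H| = a or |C ∩ H| = a + b, then C is free; equivalently, C is free if χ(C, n_H) = 0 for some line H. -/
open MvPolynomial

variable {K : Type*} [Field K]

/-- A subset of `K × K` is an affine line: the zero set of a nonzero degree-one equation. -/
def IsAffineLine (L : Set (K × K)) : Prop :=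
  ∃ a b c : K, (a, b) ≠ (0, 0) ∧ L = {p : K × K | a * p.1 + b * p.2 + c = 0}

/-- An affine line arrangement: a finite set of affine lines in `K²`. -/
def IsLineArr (A : Finset (Set (K × K))) : Prop :=
  ∀ L ∈ A, IsAffineLine L

open Classical in
/-- The second Betti number `b₂(A)` of a line arrangement, via Whitney's theorem:
`b₂(A) = ∑ (-1)^{|B|}` over the subsets `B ⊆ A` with `|B| ≥ 2` and `⋂ B ≠ ∅`. -/
noncomputable def b2 (A : Finset (Set (K × K))) : ℤ :=
  ∑ B ∈ A.powerset.filter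
      (fun B : Finset (Set (K × K)) => 2 ≤ B.card ∧ (⋂ L ∈ B, (L : Set (K × K))).Nonempty),
    (-1 : ℤ) ^ B.card

/-- The characteristic polynomial `χ(A,t) = t² − |A|·t + b₂(A)`, evaluated at `t : ℂ`. -/
noncomputable def chi (A : Finset (Set (K × K))) (t : ℂ) : ℂ :=
  t ^ 2 - (A.card : ℂ) * t + (b2 A : ℂ)

/-- `nOn A H = |A ∩ H|`: the number of intersection points, lying on the line `H`, of `H`
with the lines of `A` other than `H`. -/
noncomputable def nOn (A : Finset (Set (K × K))) (H : Set (K × K)) : ℕ :=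
  Set.ncard {p : K × K | p ∈ H ∧ ∃ L ∈ A, L ≠ H ∧ p ∈ L}

/-- The linear form `a·x + b·y + c·z` in `K[x,y,z]`. -/
noncomputable def lin3 (a b c : K) : MvPolynomial (Fin 3) K :=
  C a * X 0 + C b * X 1 + C c * X 2

/-- The action on `f` of the derivation with coefficient vector `θ`. -/
noncomputable def applyDer3 (θ : Fin 3 → MvPolynomial (Fin 3) K)
    (f : MvPolynomial (Fin 3) K) : MvPolynomial (Fin 3) K :=
  ∑ i, θ i * pderiv i f

/-- `θ` belongs to `D(cA)`, the logarithmic derivation module of the cone of `A`: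
`θ(α_H) ∈ S·α_H` for every `H ∈ cA`, where `cA` consists of the homogenizations of the
lines of `A` together with the plane `z = 0`. -/
def InDCone (A : Finset (Set (K × K))) (θ : Fin 3 → MvPolynomial (Fin 3) K) : Prop :=
  (∀ L ∈ A, ∀ a b c : K, (a, b) ≠ (0, 0) →
      L = {p : K × K | a * p.1 + b * p.2 + c = 0} →
      ∃ g, applyDer3 θ (lin3 a b c) = g * lin3 a b c) ∧
  (∃ g, applyDer3 θ (X 2) = g * (X 2 : MvPolynomial (Fin 3) K))

/-- A homogeneous derivation of degree `d` on `K[x,y,z]`. -/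
def HomogDer3 (θ : Fin 3 → MvPolynomial (Fin 3) K) (d : ℕ) : Prop :=
  ∀ i, (θ i).IsHomogeneous d

/-- `A` is free with exponents `exp₀(A) = (d₁, d₂)`: `D(cA)` is a free module with a
homogeneous basis consisting of the Euler derivation `x∂ₓ + y∂_y + z∂_z` and two
derivations of degrees `d₁` and `d₂`. -/
def IsFreeExp (A : Finset (Set (K × K))) (d₁ d₂ : ℕ) : Prop :=
  ∃ θ₁ θ₂ : Fin 3 → MvPolynomial (Fin 3) K,
    InDCone A θ₁ ∧ InDCone A θ₂ ∧ HomogDer3 θ₁ d₁ ∧ HomogDer3 θ₂ d₂ ∧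
    ∀ θ : Fin 3 → MvPolynomial (Fin 3) K, InDCone A θ →
      ∃! cfs : MvPolynomial (Fin 3) K × MvPolynomial (Fin 3) K × MvPolynomial (Fin 3) K,
        θ = fun j => cfs.1 * X j + cfs.2.1 * θ₁ j + cfs.2.2 * θ₂ j

/-- `A` is free (with some exponents). -/
def IsFree (A : Finset (Set (K × K))) : Prop := ∃ d₁ d₂ : ℕ, IsFreeExp A d₁ d₂

/-- `A` is free with (integer-valued) exponents `exp₀(A) = (d₁, d₂)`. -/
def IsFreeExpZ (A : Finset (Set (K × K))) (d₁ d₂ : ℤ) : Prop :=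
  ∃ e₁ e₂ : ℕ, (e₁ : ℤ) = d₁ ∧ (e₂ : ℤ) = d₂ ∧ IsFreeExp A e₁ e₂

/-- An affine line with a chosen equation `a * x + b * y + c = 0` and a chosen vector `(v, w)` on
which the linear part of the equation takes the value `1`. -/
structure PLine (K : Type*) [Field K] where
  /-- The coefficient of `x`. -/
  a : K
  /-- The coefficient of `y`. -/
  b : K
  /-- The constant coefficient. -/
  c : K
  /-- The first coordinate of the normalizing vector. -/
  v : K
  /-- The second coordinate of the normalizing vector. -/
  w : K
  normalized : a * v + b * w = 1

namespace PLine

/-- The points of the line. -/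
def set (l : PLine K) : Set (K × K) := {p | l.a * p.1 + l.b * p.2 + l.c = 0}

/-- The homogenized equation of the line. -/
noncomputable def form (l : PLine K) : MvPolynomial (Fin 3) K := lin3 l.a l.b l.c

/-- The restriction of a polynomial to the line, parametrized by
`t ↦ (-c * v - b * t, -c * w + a * t)`. -/
noncomputable def res (l : PLine K) : MvPolynomial (Fin 3) K →ₐ[K] Polynomial K :=
  aeval ![Polynomial.C (-l.c * l.v) - Polynomial.C l.b * Polynomial.X,
    Polynomial.C (-l.c * l.w) + Polynomial.C l.a * Polynomial.X, 1]

/-- The point of the line with parameter `t`. -/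
def point (l : PLine K) (t : K) : K × K := (-l.c * l.v - l.b * t, -l.c * l.w + l.a * t)

/-- The determinant of the linear parts of two equations; it vanishes iff the lines are
parallel. -/
def cross (l m : PLine K) : K := l.a * m.b - l.b * m.a

theorem ne_zero (l : PLine K) : (l.a, l.b) ≠ (0, 0) := by
  intro h
  have := l.normalized
  simp_all

theorem exists_mk {a b c : K} (h : (a, b) ≠ (0, 0)) :
    ∃ l : PLine K, l.a = a ∧ l.b = b ∧ l.c = c := by
  by_cases ha : a = 0
  · have hb : b ≠ 0 := by rintro rfl; simp_all
    exact ⟨⟨a, b, c, 0, b⁻¹, by simp [hb]⟩, rfl, rfl, rfl⟩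
  · exact ⟨⟨a, b, c, a⁻¹, 0, by simp [ha]⟩, rfl, rfl, rfl⟩

theorem exists_set_eq {L : Set (K × K)} (h : IsAffineLine L) : ∃ l : PLine K, l.set = L := by
  obtain ⟨a, b, c, hab, rfl⟩ := h
  obtain ⟨l, rfl, rfl, rfl⟩ := exists_mk (c := c) hab
  exact ⟨l, rfl⟩

theorem mem_set {l : PLine K} {p : K × K} : p ∈ l.set ↔ l.a * p.1 + l.b * p.2 + l.c = 0 := Iff.rfl

theorem point_mem (l : PLine K) (t : K) : l.point t ∈ l.set := by
  rw [mem_set, point]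
  linear_combination (-l.c) * l.normalized

theorem exists_point {l : PLine K} {p : K × K} (hp : p ∈ l.set) : ∃ t, p = l.point t := by
  rw [mem_set] at hp
  refine ⟨l.v * p.2 - l.w * p.1, ?_⟩
  ext
  · simp only [point]
    linear_combination (-p.1) * l.normalized + l.v * hp
  · simp only [point]
    linear_combination (-p.2) * l.normalized + l.w * hp

theorem point_injective (l : PLine K) : Function.Injective l.point := by
  intro s t h
  simp only [point, Prod.mk.injEq] at h
  linear_combination (t - s) * l.normalized - l.w * h.1 + l.v * h.2

theorem exists_smul_of_subset {l m : PLine K} (h : l.set ⊆ m.set) :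
    ∃ u, m.a = u * l.a ∧ m.b = u * l.b ∧ m.c = u * l.c := by
  have h0 := h (l.point_mem 0)
  have h1 := h (l.point_mem 1)
  simp only [mem_set, point] at h0 h1
  refine ⟨m.a * l.v + m.b * l.w, ?_, ?_, ?_⟩
  · linear_combination (-m.a) * l.normalized + l.w * (h0 - h1)
  · linear_combination (-m.b) * l.normalized + l.v * (h1 - h0)
  · linear_combination h0

theorem eq_of_subset {l m : PLine K} (h : l.set ⊆ m.set) : l.set = m.set := by
  refine h.antisymm fun p hp => ?_
  obtain ⟨u, ha, hb, hc⟩ := exists_smul_of_subset h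
  have hu : u ≠ 0 := by
    rintro rfl
    exact m.ne_zero (by simp [ha, hb])
  rw [mem_set, ha, hb, hc] at hp
  rw [mem_set]
  exact (mul_eq_zero.1 (show u * _ = 0 by linear_combination hp)).resolve_left hu

theorem form_homogeneous (l : PLine K) : l.form.IsHomogeneous 1 := by
  unfold form lin3
  exact ((isHomogeneous_C_mul_X _ _).add (isHomogeneous_C_mul_X _ _)).add
    (isHomogeneous_C_mul_X _ _)

theorem coeff_form_zero (l : PLine K) : l.form.coeff (Finsupp.single 0 1) = l.a := by
  simp [form, lin3, coeff_C_mul, coeff_X, Finsupp.single_left_inj]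

theorem coeff_form_one (l : PLine K) : l.form.coeff (Finsupp.single 1 1) = l.b := by
  simp [form, lin3, coeff_C_mul, coeff_X, Finsupp.single_left_inj]

theorem form_ne_zero (l : PLine K) : l.form ≠ 0 := by
  intro h
  have h0 := l.coeff_form_zero
  have h1 := l.coeff_form_one
  rw [h, coeff_zero] at h0 h1
  exact l.ne_zero (by rw [← h0, ← h1])

theorem prime_form (l : PLine K) : Prime l.form := by
  refine (irreducible_of_totalDegree_eq_one (l.form_homogeneous.totalDegree l.form_ne_zero)
    fun x hx => ?_).prime
  rw [isUnit_iff_ne_zero]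
  rintro rfl
  have h0 := hx (Finsupp.single 0 1)
  have h1 := hx (Finsupp.single 1 1)
  rw [zero_dvd_iff] at h0 h1
  rw [coeff_form_zero] at h0
  rw [coeff_form_one] at h1
  exact l.ne_zero (by rw [h0, h1])

theorem eval_form (l : PLine K) (p : K × K) :
    MvPolynomial.eval ![p.1, p.2, 1] l.form = l.a * p.1 + l.b * p.2 + l.c := by
  simp [form, lin3]

theorem set_eq_of_form_dvd {l m : PLine K} (h : l.form ∣ m.form) : l.set = m.set := by
  refine eq_of_subset fun p hp => ?_
  rw [mem_set, ← eval_form] at hp ⊢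
  obtain ⟨g, hg⟩ := h
  rw [hg, map_mul, hp, zero_mul]

theorem form_dvd_of_set_eq {l m : PLine K} (h : l.set = m.set) : l.form ∣ m.form := by
  obtain ⟨u, ha, hb, hc⟩ := exists_smul_of_subset h.subset
  refine ⟨C u, ?_⟩
  simp only [form, lin3, ha, hb, hc, map_mul]
  ring

theorem isRelPrime_form {l m : PLine K} (h : l.set ≠ m.set) : IsRelPrime l.form m.form :=
  l.prime_form.irreducible.isRelPrime_iff_not_dvd.2 fun hd => h (set_eq_of_form_dvd hd)

theorem res_C (l : PLine K) (r : K) : l.res (C r) = Polynomial.C r := by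
  rw [← MvPolynomial.algebraMap_eq, AlgHom.commutes, Polynomial.algebraMap_eq]

theorem res_form (l m : PLine K) :
    l.res m.form = Polynomial.C (m.a * (l.point 0).1 + m.b * (l.point 0).2 + m.c) +
      Polynomial.C (l.cross m) * Polynomial.X := by
  simp only [form, lin3, map_add, map_mul, res_C]
  simp [res, point, cross]
  ring

theorem res_form_self (l : PLine K) : l.res l.form = 0 := by
  rw [res_form, l.point_mem 0, cross]
  simp [mul_comm]

theorem natDegree_res_le (l : PLine K) {f : MvPolynomial (Fin 3) K} {d : ℕ}
    (hf : f.IsHomogeneous d) : (l.res f).natDegree ≤ d := by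
  have := aeval_natDegree_le (n := 1) f hf.totalDegree_le
    ![Polynomial.C (-l.c * l.v) - Polynomial.C l.b * Polynomial.X,
      Polynomial.C (-l.c * l.w) + Polynomial.C l.a * Polynomial.X, 1] (by
      intro i
      fin_cases i
      · simp only [Fin.zero_eta, Matrix.cons_val_zero]
        compute_degree
      · simp only [Fin.mk_one, Matrix.cons_val_one, Matrix.cons_val_zero]
        compute_degree
      · simp)
  rwa [mul_one] at this

theorem eval_res (l : PLine K) (f : MvPolynomial (Fin 3) K) (t : K) :
    (l.res f).eval t = MvPolynomial.eval ![(l.point t).1, (l.point t).2, 1] f := by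
  have : (Polynomial.aeval t).comp l.res =
      MvPolynomial.aeval ![(l.point t).1, (l.point t).2, 1] := by
    ext i
    fin_cases i <;> simp [res, point]
  have h := congrArg (fun φ => φ f) this
  simpa [MvPolynomial.aeval_eq_eval] using h

end PLine

theorem aeval_mul_of_isHomogeneous {R : Type*} [CommRing R] [Algebra K R]
    {f : MvPolynomial (Fin 3) K} {d : ℕ} (hf : f.IsHomogeneous d) (z : R) (x : Fin 3 → R) :
    aeval (fun i => z * x i) f = z ^ d * aeval x f := by
  rw [aeval_def, aeval_def, eval₂_eq', eval₂_eq', Finset.mul_sum]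
  refine Finset.sum_congr rfl fun s hs => ?_
  have hd : d = ∑ i, s i := by
    rw [hf.degree_eq_sum_deg_support hs]
    exact (Finsupp.degree_eq_sum s)
  rw [hd]
  simp only [mul_pow, Finset.prod_mul_distrib, Finset.prod_pow_eq_pow_sum]
  ring

namespace PLine

/-- The projection of `K³` onto the plane of `l` along `(v, w, 0)`. -/
noncomputable def proj (l : PLine K) : MvPolynomial (Fin 3) K →ₐ[K] MvPolynomial (Fin 3) K :=
  aeval ![X 0 - C l.v * l.form, X 1 - C l.w * l.form, X 2]

theorem form_dvd_sub_proj (l : PLine K) (f : MvPolynomial (Fin 3) K) :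
    l.form ∣ f - l.proj f := by
  rw [← Ideal.mem_span_singleton, ← Ideal.Quotient.eq]
  have : (Ideal.Quotient.mkₐ K (Ideal.span {l.form})).comp l.proj =
      Ideal.Quotient.mkₐ K (Ideal.span {l.form}) := by
    ext i
    have h0 : Ideal.Quotient.mk (Ideal.span {l.form}) l.form = 0 :=
      Ideal.Quotient.eq_zero_iff_mem.2 (Ideal.mem_span_singleton_self _)
    fin_cases i <;> simp [proj, h0]
  exact (congrArg (fun φ => φ f) this).symm

theorem proj_eq_zero (l : PLine K) {f : MvPolynomial (Fin 3) K} {d : ℕ}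
    (hf : f.IsHomogeneous d) (h : l.res f = 0) : l.proj f = 0 := by
  let ι := algebraMap (MvPolynomial (Fin 3) K) (FractionRing (MvPolynomial (Fin 3) K))
  have hι : Function.Injective ι := IsFractionRing.injective _ _
  have hz : ι (X 2) ≠ 0 := (map_ne_zero_iff _ hι).2 (X_ne_zero _)
  apply hι
  rw [map_zero]
  let t := ι (C l.v * X 1 - C l.w * X 0) / ι (X 2)
  let x : Fin 3 → FractionRing (MvPolynomial (Fin 3) K) :=
    fun i => Polynomial.aeval t (l.res (X i))
  have hn : ι (C l.a) * ι (C l.v) + ι (C l.b) * ι (C l.w) = 1 := by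
    rw [← map_mul, ← map_mul, ← map_mul, ← map_mul, ← map_add, ← map_add, l.normalized]
    simp
  have hC : ∀ r : K, algebraMap K (FractionRing (MvPolynomial (Fin 3) K)) r = ι (C r) :=
    fun r => rfl
  have ht : ι (X 2) * t = ι (C l.v) * ι (X 1) - ι (C l.w) * ι (X 0) := by
    rw [mul_div_cancel₀ _ hz, map_sub, map_mul, map_mul]
  have h1 : (fun i => ι (X 2) * x i) = fun i => ι (l.proj (X i)) := by
    funext i
    fin_cases i
    · simp only [x, res, proj, form, lin3, aeval_X, Fin.zero_eta, Matrix.cons_val_zero, map_sub,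
        map_add, map_mul, Polynomial.aeval_C, Polynomial.aeval_X, hC, map_neg]
      linear_combination (-ι (C l.b)) * ht + ι (X 0) * hn
    · simp only [x, res, proj, form, lin3, aeval_X, Fin.mk_one, Matrix.cons_val_one,
        Matrix.cons_val_zero, map_sub,
        map_add, map_mul, Polynomial.aeval_C, Polynomial.aeval_X, hC, map_neg]
      linear_combination (ι (C l.a)) * ht + ι (X 1) * hn
    · simp [x, res, proj]
  have h2 : ι (l.proj f) = aeval (fun i => ι (l.proj (X i))) f := by
    have : (IsScalarTower.toAlgHom K (MvPolynomial (Fin 3) K)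
        (FractionRing (MvPolynomial (Fin 3) K))).comp l.proj =
        aeval (fun i => ι (l.proj (X i))) := by
      ext i
      simp [ι]
    exact congrArg (fun φ => φ f) this
  have h3 : aeval x f = Polynomial.aeval t (l.res f) := by
    have : aeval x = (Polynomial.aeval t).comp l.res := by
      ext i
      simp [x]
    exact congrArg (fun φ => φ f) this
  rw [h2, ← h1, aeval_mul_of_isHomogeneous hf, h3, h, map_zero, mul_zero]

theorem res_eq_zero_iff (l : PLine K) {f : MvPolynomial (Fin 3) K} {d : ℕ}
    (hf : f.IsHomogeneous d) : l.res f = 0 ↔ l.form ∣ f := by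
  constructor
  · intro h
    have := l.form_dvd_sub_proj f
    rwa [l.proj_eq_zero hf h, sub_zero] at this
  · rintro ⟨g, rfl⟩
    rw [map_mul, res_form_self, zero_mul]

end PLine

theorem homogeneousComponent_mul_of_isHomogeneous {p g : MvPolynomial (Fin 3) K} {m d : ℕ}
    (hp : p.IsHomogeneous m) :
    homogeneousComponent (m + d) (p * g) = p * homogeneousComponent d g := by
  conv_lhs => rw [← sum_homogeneousComponent g, Finset.mul_sum, map_sum]
  have key : ∀ i, homogeneousComponent (m + d) (p * homogeneousComponent i g) =
      if i = d then p * homogeneousComponent d g else 0 := by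
    intro i
    rw [homogeneousComponent_of_mem (hp.mul (homogeneousComponent_isHomogeneous i g))]
    by_cases h : i = d
    · simp [h]
    · rw [if_neg h, if_neg (by lia)]
  rw [Finset.sum_congr rfl fun i _ => key i, Finset.sum_ite_eq']
  split_ifs with h
  · rfl
  · rw [homogeneousComponent_eq_zero, mul_zero]
    simpa using h

theorem exists_homogeneous_of_dvd {p f : MvPolynomial (Fin 3) K} {m d : ℕ}
    (hp : p.IsHomogeneous m) (hf : f.IsHomogeneous (m + d)) (h : p ∣ f) :
    ∃ g : MvPolynomial (Fin 3) K, g.IsHomogeneous d ∧ f = p * g := by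
  obtain ⟨g, rfl⟩ := h
  refine ⟨homogeneousComponent d g, homogeneousComponent_isHomogeneous d g, ?_⟩
  rw [← homogeneousComponent_mul_of_isHomogeneous hp, homogeneousComponent_eq_self hf]

namespace PLine

/-- The parameter, on the line `l`, of the intersection point with a non-parallel line `m`. -/
noncomputable def meet (l m : PLine K) : K :=
  -(m.a * (l.point 0).1 + m.b * (l.point 0).2 + m.c) / l.cross m

theorem res_form_of_cross_ne_zero {l m : PLine K} (h : l.cross m ≠ 0) :
    l.res m.form = Polynomial.C (l.cross m) * (Polynomial.X - Polynomial.C (l.meet m)) := by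
  rw [res_form, mul_sub, ← Polynomial.C_mul, meet, mul_div_cancel₀ _ h, Polynomial.C_neg]
  ring

theorem exists_res_form_of_cross_eq_zero {l m : PLine K} (hne : m.set ≠ l.set)
    (h : l.cross m = 0) : ∃ r : K, r ≠ 0 ∧ l.res m.form = Polynomial.C r := by
  have hr := l.res_form m
  rw [h, Polynomial.C_0, zero_mul, add_zero] at hr
  refine ⟨_, fun h0 => hne ?_, hr⟩
  rw [h0, Polynomial.C_0, l.res_eq_zero_iff m.form_homogeneous] at hr
  exact (set_eq_of_form_dvd hr).symm

theorem point_mem_iff {l m : PLine K} (hne : m.set ≠ l.set) (t : K) :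
    l.point t ∈ m.set ↔ l.cross m ≠ 0 ∧ l.meet m = t := by
  rw [mem_set, ← eval_form, ← eval_res]
  by_cases h : l.cross m = 0
  · obtain ⟨r, hr, hres⟩ := exists_res_form_of_cross_eq_zero hne h
    simp [hres, hr, h]
  · simp only [res_form_of_cross_ne_zero h, h, Polynomial.eval_mul, Polynomial.eval_C,
      Polynomial.eval_sub, Polynomial.eval_X, mul_eq_zero, false_or, sub_eq_zero, ne_eq,
      not_false_eq_true, true_and]
    exact eq_comm

/-- The component of a vector field transverse to `l`. -/
noncomputable def normal (l : PLine K) :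
    MvPolynomial (Fin 3) K × MvPolynomial (Fin 3) K →ₗ[K] MvPolynomial (Fin 3) K :=
  l.a • LinearMap.fst K _ _ + l.b • LinearMap.snd K _ _

/-- The component of a vector field along `l`. -/
noncomputable def tangent (l : PLine K) :
    MvPolynomial (Fin 3) K × MvPolynomial (Fin 3) K →ₗ[K] MvPolynomial (Fin 3) K :=
  l.v • LinearMap.snd K _ _ - l.w • LinearMap.fst K _ _

theorem normal_apply (l : PLine K) (θ : MvPolynomial (Fin 3) K × MvPolynomial (Fin 3) K) :
    l.normal θ = C l.a * θ.1 + C l.b * θ.2 := by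
  simp [normal, smul_eq_C_mul]

theorem tangent_apply (l : PLine K) (θ : MvPolynomial (Fin 3) K × MvPolynomial (Fin 3) K) :
    l.tangent θ = C l.v * θ.2 - C l.w * θ.1 := by
  simp [tangent, smul_eq_C_mul]

theorem C_normalized (l : PLine K) :
    (C l.a * C l.v + C l.b * C l.w : MvPolynomial (Fin 3) K) = 1 := by
  rw [← C_mul, ← C_mul, ← C_add, l.normalized, C_1]

theorem fst_eq (l : PLine K) (θ : MvPolynomial (Fin 3) K × MvPolynomial (Fin 3) K) :
    θ.1 = C l.v * l.normal θ - C l.b * l.tangent θ := by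
  rw [normal_apply, tangent_apply]
  linear_combination (-θ.1) * l.C_normalized

theorem snd_eq (l : PLine K) (θ : MvPolynomial (Fin 3) K × MvPolynomial (Fin 3) K) :
    θ.2 = C l.w * l.normal θ + C l.a * l.tangent θ := by
  rw [normal_apply, tangent_apply]
  linear_combination (-θ.2) * l.C_normalized

theorem form_dvd_normal_congr {l m : PLine K} (h : l.set = m.set)
    {θ : MvPolynomial (Fin 3) K × MvPolynomial (Fin 3) K} (hd : l.form ∣ l.normal θ) :
    m.form ∣ m.normal θ := by
  obtain ⟨u, ha, hb, -⟩ := exists_smul_of_subset h.subset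
  refine (form_dvd_of_set_eq h.symm).trans (hd.trans ⟨C u, ?_⟩)
  rw [normal_apply, normal_apply, ha, hb, C_mul, C_mul]
  ring

end PLine

/-- The homogeneous vector fields of degree `d` with vanishing `z`-component which are tangent to
all lines of `A`. -/
def logFields (A : Finset (Set (K × K))) (d : ℕ) :
    Submodule K (MvPolynomial (Fin 3) K × MvPolynomial (Fin 3) K) where
  carrier := {θ | θ.1.IsHomogeneous d ∧ θ.2.IsHomogeneous d ∧
    ∀ l : PLine K, l.set ∈ A → l.form ∣ l.normal θ}
  add_mem' := fun h h' => ⟨h.1.add h'.1, h.2.1.add h'.2.1, fun l hl => by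
    rw [map_add]
    exact dvd_add (h.2.2 l hl) (h'.2.2 l hl)⟩
  zero_mem' := ⟨isHomogeneous_zero _ _ _, isHomogeneous_zero _ _ _, fun l _ => by simp⟩
  smul_mem' := fun r θ h => ⟨by
    simpa [smul_eq_C_mul] using h.1.C_mul r, by
    simpa [smul_eq_C_mul] using h.2.1.C_mul r, fun l hl => by
    rw [map_smul, smul_eq_C_mul]
    exact Dvd.dvd.mul_left (h.2.2 l hl) _⟩

section LineArr

variable {A : Finset (Set (K × K))} {d : ℕ}
  {θ : MvPolynomial (Fin 3) K × MvPolynomial (Fin 3) K}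

theorem isHomogeneous_normal (hθ : θ ∈ logFields A d) (l : PLine K) :
    (l.normal θ).IsHomogeneous d := by
  rw [l.normal_apply]
  exact (hθ.1.C_mul _).add (hθ.2.1.C_mul _)

theorem isHomogeneous_tangent (hθ : θ ∈ logFields A d) (l : PLine K) :
    (l.tangent θ).IsHomogeneous d := by
  rw [l.tangent_apply]
  exact (hθ.2.1.C_mul _).sub (hθ.1.C_mul _)

theorem exists_pline_section (hA : IsLineArr A) :
    ∃ e : Set (K × K) → PLine K, ∀ L ∈ A, (e L).set = L := by
  classical
  have h : ∀ L, ∃ l : PLine K, L ∈ A → l.set = L := by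
    intro L
    by_cases hL : L ∈ A
    · obtain ⟨l, hl⟩ := PLine.exists_set_eq (hA L hL)
      exact ⟨l, fun _ => hl⟩
    · exact ⟨⟨1, 0, 0, 1, 0, by simp⟩, fun h => absurd h hL⟩
  choose e he using h
  exact ⟨e, he⟩

theorem prod_form_dvd {e : Set (K × K) → PLine K} (he : ∀ L ∈ A, (e L).set = L)
    {B : Finset (Set (K × K))} (hB : B ⊆ A) {f : MvPolynomial (Fin 3) K}
    (hf : ∀ L ∈ B, (e L).form ∣ f) : ∏ L ∈ B, (e L).form ∣ f := by
  refine Finset.prod_dvd_of_isRelPrime (fun L hL M hM hne => ?_) hf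
  refine PLine.isRelPrime_form ?_
  rw [he L (hB hL), he M (hB hM)]
  exact hne

open Classical in
/-- The parameters on `l` of the intersection points with the lines of `A`. -/
noncomputable def meets (A : Finset (Set (K × K))) (e : Set (K × K) → PLine K) (l : PLine K) :
    Finset K :=
  (A.filter fun L => l.cross (e L) ≠ 0).image fun L => l.meet (e L)

theorem mem_meets {e : Set (K × K) → PLine K} {l : PLine K} {t : K} :
    t ∈ meets A e l ↔ ∃ L ∈ A, l.cross (e L) ≠ 0 ∧ l.meet (e L) = t := by
  classical
  simp [meets, and_assoc]

theorem mem_meets_iff_point_mem {e : Set (K × K) → PLine K} (he : ∀ L ∈ A, (e L).set = L)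
    {l : PLine K} (hl : l.set ∉ A) {t : K} :
    t ∈ meets A e l ↔ ∃ L ∈ A, l.point t ∈ L := by
  rw [mem_meets]
  refine exists_congr fun L => and_congr_right fun hL => ?_
  rw [← PLine.point_mem_iff, he L hL]
  rw [he L hL]
  rintro rfl
  exact hl hL

theorem nOn_eq_card_meets {e : Set (K × K) → PLine K} (he : ∀ L ∈ A, (e L).set = L)
    {l : PLine K} (hl : l.set ∉ A) : nOn A l.set = (meets A e l).card := by
  have : {p : K × K | p ∈ l.set ∧ ∃ L ∈ A, L ≠ l.set ∧ p ∈ L} = l.point '' (meets A e l) := by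
    ext p
    simp only [Set.mem_ofPred_eq, Set.mem_image, Finset.mem_coe, mem_meets_iff_point_mem he hl]
    constructor
    · rintro ⟨hp, L, hL, -, hpL⟩
      obtain ⟨t, rfl⟩ := PLine.exists_point hp
      exact ⟨t, ⟨L, hL, hpL⟩, rfl⟩
    · rintro ⟨t, ⟨L, hL, hpL⟩, rfl⟩
      exact ⟨l.point_mem t, L, hL, fun h => hl (h ▸ hL), hpL⟩
  rw [nOn, this, Set.ncard_image_of_injective _ l.point_injective, Set.ncard_coe_finset]

open Classical in
theorem b2_insert {e : Set (K × K) → PLine K} (he : ∀ L ∈ A, (e L).set = L)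
    {l : PLine K} (hl : l.set ∉ A) :
    b2 (insert l.set A) = b2 A + (meets A e l).card := by
  have hne : ∀ L ∈ A, (e L).set ≠ l.set := fun L hL h => hl (h ▸ (he L hL).symm ▸ hL)
  have hpart : A.powerset.filter (fun B => 2 ≤ (insert l.set B).card ∧
      (⋂ L ∈ insert l.set B, (L : Set (K × K))).Nonempty) =
      (meets A e l).biUnion fun t => (A.filter fun L => l.point t ∈ L).powerset.erase ∅ := by
    ext B
    simp only [Finset.mem_filter, Finset.mem_powerset, Finset.mem_biUnion, Finset.mem_erase,
      Finset.set_biInter_insert]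
    constructor
    · rintro ⟨hBA, hcard, p, hpl, hp⟩
      obtain ⟨t, rfl⟩ := PLine.exists_point hpl
      rw [Finset.card_insert_of_notMem fun h => hl (hBA h)] at hcard
      obtain ⟨L, hL⟩ := Finset.card_pos.1 (show 0 < B.card by lia)
      simp only [Set.mem_iInter] at hp
      refine ⟨t, (mem_meets_iff_point_mem he hl).2 ⟨L, hBA hL, hp L hL⟩, ?_, fun M hM => ?_⟩
      · rintro rfl
        simp at hL
      · exact Finset.mem_filter.2 ⟨hBA hM, hp M hM⟩
    · rintro ⟨t, -, hne, hB⟩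
      have hBA : B ⊆ A := hB.trans (Finset.filter_subset _ _)
      refine ⟨hBA, ?_, l.point t, l.point_mem t, ?_⟩
      · rw [Finset.card_insert_of_notMem fun h => hl (hBA h)]
        have := Finset.card_pos.2 (Finset.nonempty_iff_ne_empty.2 hne)
        lia
      · simp only [Set.mem_iInter]
        exact fun L hL => (Finset.mem_filter.1 (hB hL)).2
  have hdisj : (meets A e l : Set K).PairwiseDisjoint
      fun t => (A.filter fun L => l.point t ∈ L).powerset.erase ∅ := by
    intro s _ t _ hst
    refine Finset.disjoint_left.2 fun B hs ht => hst ?_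
    simp only [Finset.mem_erase, Finset.mem_powerset] at hs ht
    obtain ⟨L, hL⟩ := Finset.nonempty_iff_ne_empty.2 hs.1
    obtain ⟨hLA, hLs⟩ := Finset.mem_filter.1 (hs.2 hL)
    have hLt := (Finset.mem_filter.1 (ht.2 hL)).2
    rw [← he L hLA, PLine.point_mem_iff (hne L hLA)] at hLs hLt
    exact hLs.2.symm.trans hLt.2
  have hsum : ∀ t ∈ meets A e l,
      ∑ B ∈ (A.filter fun L => l.point t ∈ L).powerset.erase ∅, (-1 : ℤ) ^ (B.card + 1) = 1 := by
    intro t ht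
    obtain ⟨L, hL, hLt⟩ := (mem_meets_iff_point_mem he hl).1 ht
    have h0 := Finset.sum_powerset_neg_one_pow_card_of_nonempty
      (x := A.filter fun L => l.point t ∈ L) ⟨L, Finset.mem_filter.2 ⟨hL, hLt⟩⟩
    rw [← Finset.add_sum_erase _ _ (Finset.empty_mem_powerset _)] at h0
    simp only [pow_succ, ← Finset.sum_mul]
    simp only [Finset.card_empty, pow_zero] at h0
    linarith
  unfold b2
  rw [Finset.sum_filter, Finset.sum_powerset_insert hl, ← Finset.sum_filter, ← Finset.sum_filter,
    hpart, Finset.sum_biUnion hdisj]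
  congr 1
  rw [Finset.card_eq_sum_ones, Nat.cast_sum]
  refine Finset.sum_congr rfl fun t ht => ?_
  refine Eq.trans ?_ ((hsum t ht).trans Nat.cast_one.symm)
  refine Finset.sum_congr rfl fun B hB => ?_
  have hB' : l.set ∉ B := fun h =>
    hl (Finset.mem_filter.1 (Finset.mem_powerset.1 (Finset.mem_of_mem_erase hB) h)).1
  rw [Finset.card_insert_of_notMem hB']

theorem pow_dvd_res_normal {e : Set (K × K) → PLine K} (he : ∀ L ∈ A, (e L).set = L)
    {l : PLine K} (hl : l.set ∉ A) (hθ : θ ∈ logFields A d) {B : Finset (Set (K × K))}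
    (hB : B ⊆ A) {t : K} (hBt : ∀ L ∈ B, l.cross (e L) ≠ 0 ∧ l.meet (e L) = t) :
    (Polynomial.X - Polynomial.C t) ^ (B.card - 1) ∣ l.res (l.normal θ) := by
  rcases Nat.eq_zero_or_pos B.card with h0 | hpos
  · simp [h0]
  have hne : ∀ L ∈ A, (e L).set ≠ l.set := fun L hL h => hl (h ▸ (he L hL).symm ▸ hL)
  let p := l.point t
  let W : MvPolynomial (Fin 3) K := θ.1 * (X 1 - C p.2 * X 2) - θ.2 * (X 0 - C p.1 * X 2)
  have hW : ∀ L ∈ B, (e L).form ∣ W := by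
    intro L hL
    have hp : p ∈ (e L).set := (PLine.point_mem_iff (hne L (hB hL)) t).2 (hBt L hL)
    obtain ⟨q, hq⟩ := hθ.2.2 (e L) ((he L (hB hL)).symm ▸ hB hL)
    rw [PLine.normal_apply] at hq
    set m := e L
    have hform : m.form =
        C m.a * (X 0 - C p.1 * X 2) + C m.b * (X 1 - C p.2 * X 2) := by
      have hc : m.c = -(m.a * p.1) - m.b * p.2 := by
        rw [PLine.mem_set] at hp
        linear_combination hp
      simp only [PLine.form, lin3, hc, C_sub, C_neg, C_mul]
      ring
    refine ⟨C m.v * (q * (X 1 - C p.2 * X 2) - θ.2) + C m.w * (θ.1 - q * (X 0 - C p.1 * X 2)), ?_⟩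
    simp only [W]
    linear_combination (-(θ.1 * (X 1 - C p.2 * X 2) - θ.2 * (X 0 - C p.1 * X 2))) *
      m.C_normalized + (C m.v * (X 1 - C p.2 * X 2) - C m.w * (X 0 - C p.1 * X 2)) * hq +
      (C m.v * θ.2 - C m.w * θ.1) * hform
  have hres := map_dvd l.res (prod_form_dvd he hB hW)
  have hresW : l.res W = (Polynomial.X - Polynomial.C t) * l.res (l.normal θ) := by
    have h0 : l.res (X 0 - C p.1 * X 2) =
        -(Polynomial.C l.b * (Polynomial.X - Polynomial.C t)) := by
      simp only [map_sub, map_mul, PLine.res_C]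
      simp [PLine.res, p, PLine.point]
      ring
    have h1 : l.res (X 1 - C p.2 * X 2) = Polynomial.C l.a * (Polynomial.X - Polynomial.C t) := by
      simp only [map_sub, map_mul, PLine.res_C]
      simp [PLine.res, p, PLine.point]
      ring
    simp only [W, PLine.normal_apply, map_sub l.res (_ * _) (_ * _), map_mul l.res _ (_ - _), h0,
      h1, map_add, map_mul, PLine.res_C]
    ring
  rw [hresW, map_prod, Finset.prod_congr rfl fun L hL => by
    rw [PLine.res_form_of_cross_ne_zero (hBt L hL).1, (hBt L hL).2], Finset.prod_mul_distrib,
    Finset.prod_const] at hres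
  have h := dvd_of_mul_left_dvd hres
  obtain ⟨k, hk⟩ : ∃ k, B.card = k + 1 := ⟨B.card - 1, by lia⟩
  rw [hk, pow_succ'] at h
  rw [hk, Nat.add_sub_cancel]
  exact (mul_dvd_mul_iff_left (Polynomial.X_sub_C_ne_zero t)).1 h

theorem natDegree_res_normal_add_card_le {e : Set (K × K) → PLine K}
    (he : ∀ L ∈ A, (e L).set = L) {l : PLine K} (hl : l.set ∉ A) (hθ : θ ∈ logFields A d)
    {B : Finset (Set (K × K))} (hB : B ⊆ A) (hBt : ∀ L ∈ B, l.cross (e L) = 0)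
    (h0 : l.res (l.normal θ) ≠ 0) : (l.res (l.normal θ)).natDegree + B.card ≤ d := by
  have hne : ∀ L ∈ A, (e L).set ≠ l.set := fun L hL h => hl (h ▸ (he L hL).symm ▸ hL)
  have hd : ∀ L ∈ B, (e L).form ∣ l.normal θ := by
    intro L hL
    obtain ⟨q, hq⟩ := hθ.2.2 (e L) ((he L (hB hL)).symm ▸ hB hL)
    rw [PLine.normal_apply] at hq
    have hcr := hBt L hL
    set m := e L
    refine ⟨q * (C l.a * C m.v + C l.b * C m.w), ?_⟩
    have hcr' : (C l.a * C m.b - C l.b * C m.a : MvPolynomial (Fin 3) K) = 0 := by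
      rw [← C_mul, ← C_mul, ← C_sub, show l.a * m.b - l.b * m.a = 0 from hcr, C_0]
    rw [PLine.normal_apply]
    linear_combination (C l.a * C m.v + C l.b * C m.w) * hq -
      (C l.a * θ.1 + C l.b * θ.2) * m.C_normalized + (C m.w * θ.1 - C m.v * θ.2) * hcr'
  have hhom : (∏ L ∈ B, (e L).form).IsHomogeneous B.card := by
    simpa using IsHomogeneous.prod B (fun L => (e L).form) (fun _ => 1)
      fun L _ => (e L).form_homogeneous
  have hn := isHomogeneous_normal hθ l
  have hn0 : l.normal θ ≠ 0 := fun h => h0 (by rw [h, map_zero])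
  have hdvd := prod_form_dvd he hB hd
  have hcard : B.card ≤ d := by
    have := totalDegree_le_of_dvd_of_isDomain hdvd hn0
    rwa [hn.totalDegree hn0, hhom.totalDegree (ne_zero_of_dvd_ne_zero hn0 hdvd)] at this
  obtain ⟨k, rfl⟩ := Nat.exists_eq_add_of_le hcard
  obtain ⟨q, hq, hq'⟩ := exists_homogeneous_of_dvd hhom hn hdvd
  have hc : ∃ r : K, l.res (∏ L ∈ B, (e L).form) = Polynomial.C r := by
    choose! r hr using fun L (hL : L ∈ B) =>
      PLine.exists_res_form_of_cross_eq_zero (hne L (hB hL)) (hBt L hL)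
    exact ⟨∏ L ∈ B, r L, by rw [map_prod, map_prod, Finset.prod_congr rfl fun L hL => (hr L hL).2]⟩
  obtain ⟨r, hr⟩ := hc
  have := l.natDegree_res_le hq
  have h2 := Polynomial.natDegree_C_mul_le r (l.res q)
  rw [hq', map_mul, hr]
  lia

end LineArr

theorem finrank_homogeneousSubmodule (d : ℕ) :
    2 * Module.finrank K (homogeneousSubmodule (Fin 3) K d) = (d + 1) * (d + 2) := by
  have h1 : Module.finrank K (homogeneousSubmodule (Fin 3) K d) = (2 + d).choose 2 := by
    rw [homogeneousSubmodule_eq_finsupp_supported]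
    refine (Module.finrank_eq_nat_card_basis
      (basisRestrictSupport K {s : Fin 3 →₀ ℕ | s.degree = d})).trans ?_
    have hset : {s : Fin 3 →₀ ℕ | s.degree = d} =
        (Finset.univ.finsuppAntidiag d : Finset (Fin 3 →₀ ℕ)) := by
      ext s
      simp [Finsupp.degree_eq_sum]
    rw [hset, Nat.card_eq_card_toFinset, Finset.toFinset_coe,
      Finset.card_finsuppAntidiag_nat_eq_choose, Finset.card_univ, Fintype.card_fin,
      show 3 + d - 1 = 2 + d by lia, Nat.choose_symm_add]
  have h2 := Nat.add_one_mul_choose_eq (d + 1) 1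
  rw [Nat.choose_one_right] at h2
  rw [h1, show 2 + d = d + 1 + 1 by lia]
  linarith

instance (d : ℕ) : Module.Finite K (homogeneousSubmodule (Fin 3) K d) :=
  Module.Finite.iff_fg.2 (homogeneousSubmodule_fg _ _ d)

/-- Without lines, a vector field is a pair of polynomials. -/
def logFieldsEmptyEquiv (d : ℕ) : logFields (∅ : Finset (Set (K × K))) d ≃ₗ[K]
    homogeneousSubmodule (Fin 3) K d × homogeneousSubmodule (Fin 3) K d where
  toFun θ := (⟨θ.1.1, θ.2.1⟩, ⟨θ.1.2, θ.2.2.1⟩)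
  invFun f := ⟨(f.1.1, f.2.1), f.1.2, f.2.2, fun _ h => absurd h (Finset.notMem_empty _)⟩
  map_add' _ _ := rfl
  map_smul' _ _ := rfl

theorem finrank_logFields_empty (d : ℕ) :
    Module.finrank K (logFields (∅ : Finset (Set (K × K))) d) = (d + 1) * (d + 2) := by
  rw [(logFieldsEmptyEquiv d).finrank_eq, Module.finrank_prod,
    ← finrank_homogeneousSubmodule (K := K), two_mul]

theorem logFields_anti {A B : Finset (Set (K × K))} (h : A ⊆ B) (d : ℕ) :
    logFields B d ≤ logFields A d :=
  fun _ hθ => ⟨hθ.1, hθ.2.1, fun l hl => hθ.2.2 l (h hl)⟩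

instance (A : Finset (Set (K × K))) (d : ℕ) : Module.Finite K (logFields A d) := by
  have : Module.Finite K (logFields (∅ : Finset (Set (K × K))) d) := 
    Module.Finite.equiv (logFieldsEmptyEquiv d).symm
  exact Submodule.finiteDimensional_of_le (logFields_anti (Finset.empty_subset A) d)

theorem finrank_le_of_dvd {W : Submodule K (Polynomial K)} {P : Polynomial K} (hP : P ≠ 0) {N : ℕ}
    (hW : ∀ f ∈ W, P ∣ f ∧ (f ≠ 0 → f.natDegree < N)) :
    Module.finrank K W ≤ N - P.natDegree := by
  have hle : W ≤ (Polynomial.degreeLT K (N - P.natDegree)).map (LinearMap.mulLeft K P) := by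
    intro f hf
    obtain ⟨⟨q, rfl⟩, hdeg⟩ := hW f hf
    refine ⟨q, ?_, rfl⟩
    rw [SetLike.mem_coe, Polynomial.mem_degreeLT]
    by_cases hq : q = 0
    · simp [hq]
    · have := hdeg (mul_ne_zero hP hq)
      rw [Polynomial.natDegree_mul hP hq] at this
      rw [Polynomial.degree_eq_natDegree hq]
      exact_mod_cast (by lia : q.natDegree < N - P.natDegree)
  refine (Submodule.finrank_mono hle).trans ((Submodule.finrank_map_le _ _).trans_eq ?_)
  rw [Module.finrank_eq_card_basis (Polynomial.degreeLT.basis K _), Fintype.card_fin]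

theorem finrank_map_add_finrank_inf_ker {V W : Type*} [AddCommGroup V] [Module K V]
    [AddCommGroup W] [Module K W] (f : V →ₗ[K] W) (p : Submodule K V) [Module.Finite K p] :
    Module.finrank K (p.map f) + Module.finrank K (p ⊓ LinearMap.ker f : Submodule K V) =
      Module.finrank K p := by
  rw [← LinearMap.finrank_range_add_finrank_ker (f.domRestrict p), LinearMap.range_domRestrict,
    LinearMap.ker_domRestrict]
  congr 1
  rw [← Submodule.map_comap_subtype]
  exact Submodule.finrank_map_subtype_eq p _

/-- The restriction to `l` of the component transverse to `l`. -/
noncomputable def PLine.resNormal (l : PLine K) :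
    MvPolynomial (Fin 3) K × MvPolynomial (Fin 3) K →ₗ[K] Polynomial K :=
  l.res.toLinearMap ∘ₗ l.normal

/-- The restriction to `l` of the component along `l`. -/
noncomputable def PLine.resTangent (l : PLine K) :
    MvPolynomial (Fin 3) K × MvPolynomial (Fin 3) K →ₗ[K] Polynomial K :=
  l.res.toLinearMap ∘ₗ l.tangent

theorem PLine.resNormal_apply (l : PLine K) (θ : MvPolynomial (Fin 3) K × MvPolynomial (Fin 3) K) :
    l.resNormal θ = l.res (l.normal θ) := rfl

theorem PLine.resTangent_apply (l : PLine K)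
    (θ : MvPolynomial (Fin 3) K × MvPolynomial (Fin 3) K) :
    l.resTangent θ = l.res (l.tangent θ) := rfl

theorem pairwise_isCoprime_X_sub_C (s : Set K) (k : K → ℕ) :
    s.Pairwise (Function.onFun IsCoprime fun t => (Polynomial.X - Polynomial.C t) ^ k t) :=
  fun _ _ _ _ hst => (Polynomial.isCoprime_X_sub_C_of_isUnit_sub
    (sub_ne_zero.2 hst).isUnit).pow

section Insert

variable {A : Finset (Set (K × K))} {d : ℕ}
  {θ : MvPolynomial (Fin 3) K × MvPolynomial (Fin 3) K}
  {e : Set (K × K) → PLine K} {l : PLine K}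

open Classical in
theorem mem_logFields_insert : θ ∈ logFields (insert l.set A) d ↔
    θ ∈ logFields A d ∧ l.resNormal θ = 0 := by
  constructor
  · intro h
    refine ⟨logFields_anti (Finset.subset_insert _ _) d h, ?_⟩
    rw [PLine.resNormal_apply, l.res_eq_zero_iff (isHomogeneous_normal h l)]
    exact h.2.2 l (Finset.mem_insert_self _ _)
  · rintro ⟨h, h0⟩
    rw [PLine.resNormal_apply, l.res_eq_zero_iff (isHomogeneous_normal h l)] at h0
    refine ⟨h.1, h.2.1, fun m hm => ?_⟩
    rcases Finset.mem_insert.1 hm with hm | hm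
    · exact PLine.form_dvd_normal_congr hm.symm h0
    · exact h.2.2 m hm

open Classical in
theorem finrank_resNormal_add : Module.finrank K ((logFields A d).map l.resNormal) +
    Module.finrank K (logFields (insert l.set A) d) = Module.finrank K (logFields A d) := by
  have : logFields (insert l.set A) d = logFields A d ⊓ LinearMap.ker l.resNormal := by
    ext θ
    exact mem_logFields_insert
  rw [this, finrank_map_add_finrank_inf_ker]

theorem finrank_resNormal_le (he : ∀ L ∈ A, (e L).set = L) (hl : l.set ∉ A) :
    Module.finrank K ((logFields A d).map l.resNormal) ≤
      d + 1 - (A.card - (meets A e l).card) := by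
  classical
  let F := A.filter fun L => l.cross (e L) ≠ 0
  let G := A.filter fun L => ¬ l.cross (e L) ≠ 0
  let k : K → ℕ := fun t => (F.filter fun L => l.meet (e L) = t).card
  let P : Polynomial K := ∏ t ∈ meets A e l, (Polynomial.X - Polynomial.C t) ^ (k t - 1)
  have hFG : F.card + G.card = A.card := Finset.card_filter_add_card_filter_not _
  have hk : ∑ t ∈ meets A e l, k t = F.card :=
    (Finset.card_eq_sum_card_fiberwise fun L hL => Finset.mem_image_of_mem _ hL).symm
  have hk1 : ∀ t ∈ meets A e l, 1 ≤ k t := by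
    intro t ht
    obtain ⟨L, hL, hc, hm⟩ := mem_meets.1 ht
    exact Finset.card_pos.2 ⟨L, Finset.mem_filter.2 ⟨Finset.mem_filter.2 ⟨hL, hc⟩, hm⟩⟩
  have hPdeg : P.natDegree + (meets A e l).card = F.card := by
    rw [Polynomial.natDegree_prod_of_monic _ _ fun t _ => (Polynomial.monic_X_sub_C t).pow _, ← hk,
      Finset.card_eq_sum_ones, ← Finset.sum_add_distrib]
    refine Finset.sum_congr rfl fun t ht => ?_
    have := hk1 t ht
    rw [Polynomial.natDegree_pow, Polynomial.natDegree_X_sub_C]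
    lia
  have hP : P ≠ 0 :=
    (Polynomial.monic_prod_of_monic _ _ fun t _ => (Polynomial.monic_X_sub_C t).pow _).ne_zero
  refine (finrank_le_of_dvd hP (N := d + 1 - G.card) ?_).trans (by lia)
  rintro _ ⟨θ, hθ, rfl⟩
  rw [PLine.resNormal_apply]
  constructor
  · refine Finset.prod_dvd_of_coprime (pairwise_isCoprime_X_sub_C _ _) fun t _ => ?_
    refine pow_dvd_res_normal he hl hθ
      ((Finset.filter_subset _ _).trans (Finset.filter_subset _ _)) fun L hL => ?_
    rw [Finset.mem_filter, Finset.mem_filter] at hL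
    exact ⟨hL.1.2, hL.2⟩
  · intro h0
    have := natDegree_res_normal_add_card_le he hl hθ (B := G) (Finset.filter_subset _ _)
      (fun L hL => not_not.1 (Finset.mem_filter.1 hL).2) h0
    lia

open Classical in
theorem PLine.resTangent_formulas (h : θ ∈ logFields (insert l.set A) d) :
    l.res θ.1 = -(Polynomial.C l.b * l.resTangent θ) ∧
      l.res θ.2 = Polynomial.C l.a * l.resTangent θ := by
  have h0 := (mem_logFields_insert.1 h).2
  rw [PLine.resNormal_apply] at h0
  constructor
  · rw [l.fst_eq θ, map_sub, map_mul, map_mul, h0, l.res_C, l.res_C, PLine.resTangent_apply]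
    ring
  · rw [l.snd_eq θ, map_add, map_mul, map_mul, h0, l.res_C, l.res_C, PLine.resTangent_apply]
    ring

open Classical in
theorem finrank_resTangent_le (he : ∀ L ∈ A, (e L).set = L) :
    Module.finrank K ((logFields (insert l.set A) d).map l.resTangent) ≤
      d + 1 - (meets A e l).card := by
  let P : Polynomial K := ∏ t ∈ meets A e l, (Polynomial.X - Polynomial.C t) ^ 1
  have hP : P ≠ 0 :=
    (Polynomial.monic_prod_of_monic _ _ fun t _ => (Polynomial.monic_X_sub_C t).pow _).ne_zero
  have hPdeg : P.natDegree = (meets A e l).card := by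
    rw [Polynomial.natDegree_prod_of_monic _ _ fun t _ => (Polynomial.monic_X_sub_C t).pow _]
    simp
  rw [← hPdeg]
  refine finrank_le_of_dvd hP ?_
  rintro _ ⟨θ, hθ, rfl⟩
  constructor
  · refine Finset.prod_dvd_of_coprime (pairwise_isCoprime_X_sub_C _ _) fun t ht => ?_
    obtain ⟨L, hL, hc, hm⟩ := mem_meets.1 ht
    have hd := map_dvd l.res (hθ.2.2 (e L) (Finset.mem_insert_of_mem ((he L hL).symm ▸ hL)))
    obtain ⟨h1, h2⟩ := PLine.resTangent_formulas hθ
    have heq : l.res ((e L).normal θ) = Polynomial.C (l.cross (e L)) * l.resTangent θ := by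
      rw [PLine.normal_apply, map_add, map_mul, map_mul, h1, h2, l.res_C, l.res_C, PLine.cross,
        Polynomial.C_sub, Polynomial.C_mul, Polynomial.C_mul]
      ring
    rw [heq, PLine.res_form_of_cross_ne_zero hc, hm] at hd
    rw [pow_one]
    exact (mul_dvd_mul_iff_left (Polynomial.C_ne_zero.2 hc)).1 hd
  · intro _
    exact Nat.lt_succ_of_le (l.natDegree_res_le (isHomogeneous_tangent hθ l))

open Classical in
theorem form_dvd_of_resTangent_eq_zero (h : θ ∈ logFields (insert l.set A) d)
    (h0 : l.resTangent θ = 0) : l.form ∣ θ.1 ∧ l.form ∣ θ.2 := by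
  obtain ⟨h1, h2⟩ := PLine.resTangent_formulas h
  rw [h0, mul_zero] at h1 h2
  rw [neg_zero, l.res_eq_zero_iff h.1] at h1
  rw [l.res_eq_zero_iff h.2.1] at h2
  exact ⟨h1, h2⟩

open Classical in
theorem finrank_logFields_insert_succ_le (hl : l.set ∉ A) :
    Module.finrank K (logFields (insert l.set A) (d + 1)) ≤
      Module.finrank K ((logFields (insert l.set A) (d + 1)).map l.resTangent) +
        Module.finrank K (logFields A d) := by
  rw [← finrank_map_add_finrank_inf_ker l.resTangent]
  refine Nat.add_le_add_left ?_ _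
  refine (Submodule.finrank_mono (t := (logFields A d).map
    (LinearMap.prodMap (LinearMap.mulLeft K l.form) (LinearMap.mulLeft K l.form))) ?_).trans
    (Submodule.finrank_map_le _ _)
  rintro ⟨f, g⟩ ⟨hθ, h0⟩
  obtain ⟨h1, h2⟩ := form_dvd_of_resTangent_eq_zero hθ h0
  obtain ⟨f', hf', rfl⟩ := exists_homogeneous_of_dvd l.form_homogeneous
    (by rw [add_comm]; exact hθ.1) h1
  obtain ⟨g', hg', rfl⟩ := exists_homogeneous_of_dvd l.form_homogeneous
    (by rw [add_comm]; exact hθ.2.1) h2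
  refine ⟨(f', g'), ⟨hf', hg', fun m hm => ?_⟩, rfl⟩
  have hd := hθ.2.2 m (Finset.mem_insert_of_mem hm)
  have heq : m.normal (l.form * f', l.form * g') = l.form * m.normal (f', g') := by
    rw [PLine.normal_apply, PLine.normal_apply]
    ring
  rw [heq] at hd
  refine (m.prime_form.dvd_or_dvd hd).resolve_left fun h => hl ?_
  rwa [← PLine.set_eq_of_form_dvd h]

open Classical in
theorem finrank_logFields_insert_zero_le :
    Module.finrank K (logFields (insert l.set A) 0) ≤
      Module.finrank K ((logFields (insert l.set A) 0).map l.resTangent) := by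
  rw [← finrank_map_add_finrank_inf_ker l.resTangent (logFields (insert l.set A) 0)]
  have hbot : logFields (insert l.set A) 0 ⊓ LinearMap.ker l.resTangent = ⊥ := by
    rw [eq_bot_iff]
    rintro ⟨f, g⟩ ⟨hθ, h0⟩
    have key : ∀ f : MvPolynomial (Fin 3) K, f.IsHomogeneous 0 → l.form ∣ f → f = 0 := by
      intro f hf hd
      by_contra hne
      have := totalDegree_le_of_dvd_of_isDomain hd hne
      rw [hf.totalDegree hne, l.form_homogeneous.totalDegree l.form_ne_zero] at this
      lia
    obtain ⟨h1, h2⟩ := form_dvd_of_resTangent_eq_zero hθ h0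
    exact Prod.ext (key f hθ.1 h1) (key g hθ.2.1 h2)
  rw [hbot, finrank_bot, add_zero]

open Classical in
theorem finrank_logFields_le (hl : l.set ∉ A) :
    Module.finrank K (logFields A d) ≤ ∑ k ∈ Finset.range (d + 1),
      (Module.finrank K ((logFields A k).map l.resNormal) +
        Module.finrank K ((logFields (insert l.set A) k).map l.resTangent)) := by
  induction d with
  | zero =>
    have h1 := finrank_resNormal_add (A := A) (d := 0) (l := l)
    have h2 := finrank_logFields_insert_zero_le (A := A) (l := l)
    rw [Finset.sum_range_one]
    lia
  | succ d ih =>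
    rw [Finset.sum_range_succ]
    have h1 := finrank_resNormal_add (A := A) (d := d + 1) (l := l)
    have h2 := finrank_logFields_insert_succ_le (A := A) (d := d) hl
    lia

theorem sum_range_add_one_sub (m k : ℕ) :
    2 * ∑ i ∈ Finset.range (m + k), (i + 1 - m) = k * (k + 1) := by
  induction k with
  | zero =>
    rw [add_zero, Finset.sum_eq_zero fun i hi => by rw [Finset.mem_range] at hi; lia]
    simp
  | succ k ih =>
    rw [← add_assoc, Finset.sum_range_succ, mul_add, ih, show m + k + 1 - m = k + 1 by lia]
    ring

theorem card_meets_le : (meets A e l).card ≤ A.card := by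
  classical
  exact Finset.card_image_le.trans (Finset.card_filter_le _ _)

theorem le_finrank_logFields (he : ∀ L ∈ A, (e L).set = L) (hd : A.card ≤ d + 1) :
    2 * ((d : ℤ) + 1) * (d + 2) + A.card * (A.card - 1) ≤
      2 * Module.finrank K (logFields A d) + 2 * (d + 1) * A.card + 2 * b2 A := by
  classical
  induction A using Finset.induction_on with
  | empty =>
    have hb : b2 (∅ : Finset (Set (K × K))) = 0 := by
      rw [b2, Finset.sum_eq_zero]
      intro B hB
      rw [Finset.mem_filter, Finset.mem_powerset, Finset.subset_empty] at hB
      obtain ⟨rfl, h, -⟩ := hB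
      simp at h
    rw [finrank_logFields_empty, hb]
    push_cast
    simp
    linarith
  | insert L A hL ih =>
    have he' : ∀ M ∈ A, (e M).set = M := fun M hM => he M (Finset.mem_insert_of_mem hM)
    rw [Finset.card_insert_of_notMem hL] at hd
    obtain ⟨l, rfl⟩ : ∃ l : PLine K, l.set = L := ⟨e L, he L (Finset.mem_insert_self _ _)⟩
    have h1 := finrank_resNormal_add (A := A) (d := d) (l := l)
    have h2 := finrank_resNormal_le (d := d) he' hL
    have h3 := b2_insert he' hL
    have h4 := ih he' (by lia)
    have h5 : (meets A e l).card ≤ A.card := card_meets_le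
    rw [Finset.card_insert_of_notMem hL, h3]
    push_cast
    zify [h5, (by lia : A.card - (meets A e l).card ≤ d + 1)] at h1 h2
    linarith

theorem exists_logFields_ne_zero (he : ∀ L ∈ A, (e L).set = L) (hl : l.set ∉ A)
    (hb : b2 A = (meets A e l).card * ((A.card : ℤ) - (meets A e l).card)) :
    (∃ θ ∈ logFields (insert l.set A) (meets A e l).card, l.resTangent θ ≠ 0) ∧
      ∃ θ ∈ logFields A (A.card - (meets A e l).card), l.resNormal θ ≠ 0 := by
  classical
  set r := (meets A e l).card with hr
  have hrn : r ≤ A.card := card_meets_le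
  obtain ⟨s, hs⟩ := Nat.exists_eq_add_of_le hrn
  have hsub : A.card - r = s := by lia
  have hlow := le_finrank_logFields (d := A.card) he (by lia)
  have hup := finrank_logFields_le (d := A.card) hl
  have hi : ∀ k, Module.finrank K ((logFields A k).map l.resNormal) ≤ k + 1 - s :=
    fun k => (finrank_resNormal_le he hl).trans_eq (by rw [← hr, hsub])
  have hj : ∀ k, Module.finrank K ((logFields (insert l.set A) k).map l.resTangent) ≤ k + 1 - r :=
    fun k => finrank_resTangent_le he
  have h1 := sum_range_add_one_sub r (s + 1)
  have h2 := sum_range_add_one_sub s (r + 1)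
  rw [show r + (s + 1) = A.card + 1 by lia] at h1
  rw [show s + (r + 1) = A.card + 1 by lia] at h2
  have hsum : ∑ k ∈ Finset.range (A.card + 1), ((k + 1 - s) + (k + 1 - r)) ≤
      Module.finrank K (logFields A A.card) := by
    rw [Finset.sum_add_distrib]
    rw [hb] at hlow
    zify at h1 h2 ⊢
    rw [hs] at hlow h1 h2 ⊢
    push_cast at hlow h1 h2 ⊢
    linarith
  have hex : ∀ {V : Type _} [AddCommGroup V] [Module K V] {p : Submodule K V}
      {f : V →ₗ[K] Polynomial K}, Module.finrank K (p.map f) ≠ 0 → ∃ θ ∈ p, f θ ≠ 0 := by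
    intro V _ _ p f h
    by_contra! hall
    have hbot : p.map f = ⊥ := by
      rw [Submodule.eq_bot_iff]
      rintro _ ⟨θ, hθ, rfl⟩
      exact hall θ hθ
    exact h (by rw [hbot, finrank_bot])
  rw [hsub]
  constructor
  · refine hex fun h0 => absurd hup (not_le.2 (lt_of_lt_of_le ?_ hsum))
    refine Finset.sum_lt_sum (fun k _ => add_le_add (hi k) (hj k))
      ⟨r, Finset.mem_range.2 (by lia), add_lt_add_of_le_of_lt (hi r) ?_⟩
    lia
  · refine hex fun h0 => absurd hup (not_le.2 (lt_of_lt_of_le ?_ hsum))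
    refine Finset.sum_lt_sum (fun k _ => add_le_add (hi k) (hj k))
      ⟨s, Finset.mem_range.2 (by lia), add_lt_add_of_lt_of_le ?_ (hj s)⟩
    lia

end Insert

theorem applyDer3_lin3 (θ : Fin 3 → MvPolynomial (Fin 3) K) (a b c : K) :
    applyDer3 θ (lin3 a b c) = C a * θ 0 + C b * θ 1 + C c * θ 2 := by
  simp [applyDer3, lin3, Fin.sum_univ_three, pderiv_X, Pi.single_apply, mul_comm]

theorem applyDer3_X_two (θ : Fin 3 → MvPolynomial (Fin 3) K) : applyDer3 θ (X 2) = θ 2 := by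
  simp [applyDer3, pderiv_X, Pi.single_apply]

theorem inDCone_of_mem_logFields {A : Finset (Set (K × K))} {d : ℕ}
    {θ : MvPolynomial (Fin 3) K × MvPolynomial (Fin 3) K} (h : θ ∈ logFields A d) :
    InDCone A ![θ.1, θ.2, 0] := by
  refine ⟨?_, 0, by simp [applyDer3_X_two]⟩
  rintro L hL a b c hab rfl
  obtain ⟨l, rfl, rfl, rfl⟩ := PLine.exists_mk (c := c) hab
  obtain ⟨g, hg⟩ := h.2.2 l hL
  refine ⟨g, ?_⟩
  rw [PLine.normal_apply] at hg
  rw [applyDer3_lin3, mul_comm g]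
  simpa [PLine.form] using hg

theorem homogDer3_of_mem_logFields {A : Finset (Set (K × K))} {d : ℕ}
    {θ : MvPolynomial (Fin 3) K × MvPolynomial (Fin 3) K} (h : θ ∈ logFields A d) :
    HomogDer3 ![θ.1, θ.2, 0] d := by
  intro i
  fin_cases i
  · exact h.1
  · exact h.2.1
  · exact isHomogeneous_zero _ _ _

theorem PLine.form_dvd_det {l : PLine K} {φ ψ : MvPolynomial (Fin 3) K × MvPolynomial (Fin 3) K}
    (hφ : l.form ∣ l.normal φ) (hψ : l.form ∣ l.normal ψ) :
    l.form ∣ φ.1 * ψ.2 - φ.2 * ψ.1 := by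
  have h : φ.1 * ψ.2 - φ.2 * ψ.1 = l.normal φ * l.tangent ψ - l.normal ψ * l.tangent φ := by
    rw [normal_apply, normal_apply, tangent_apply, tangent_apply]
    linear_combination (-(φ.1 * ψ.2 - φ.2 * ψ.1)) * l.C_normalized
  rw [h]
  exact dvd_sub (hφ.mul_right _) (hψ.mul_right _)

/-- The Saito criterion for cones of line arrangements. -/
theorem isFreeExp_of_det_ne_zero {A : Finset (Set (K × K))} (hA : IsLineArr A) {d₁ d₂ : ℕ}
    {φ ψ : MvPolynomial (Fin 3) K × MvPolynomial (Fin 3) K} (hφ : φ ∈ logFields A d₁)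
    (hψ : ψ ∈ logFields A d₂) (hd : d₁ + d₂ = A.card) (hdet : φ.1 * ψ.2 - φ.2 * ψ.1 ≠ 0) :
    IsFreeExp A d₁ d₂ := by
  refine ⟨_, _, inDCone_of_mem_logFields hφ, inDCone_of_mem_logFields hψ,
    homogDer3_of_mem_logFields hφ, homogDer3_of_mem_logFields hψ, fun θ hθ => ?_⟩
  obtain ⟨e, he⟩ := exists_pline_section hA
  have hQ : (∏ L ∈ A, (e L).form).IsHomogeneous A.card := by
    simpa using IsHomogeneous.prod A (fun L => (e L).form) (fun _ => 1)
      fun L _ => (e L).form_homogeneous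
  have hdvd {χ χ' : MvPolynomial (Fin 3) K × MvPolynomial (Fin 3) K}
      (h : ∀ L ∈ A, (e L).form ∣ (e L).normal χ) (h' : ∀ L ∈ A, (e L).form ∣ (e L).normal χ') :
      ∏ L ∈ A, (e L).form ∣ χ.1 * χ'.2 - χ.2 * χ'.1 :=
    prod_form_dvd he subset_rfl fun L hL => PLine.form_dvd_det (h L hL) (h' L hL)
  have hφ' : ∀ L ∈ A, (e L).form ∣ (e L).normal φ :=
    fun L hL => hφ.2.2 _ ((he L hL).symm ▸ hL)
  have hψ' : ∀ L ∈ A, (e L).form ∣ (e L).normal ψ :=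
    fun L hL => hψ.2.2 _ ((he L hL).symm ▸ hL)
  obtain ⟨u, hu⟩ : ∃ u : K, φ.1 * ψ.2 - φ.2 * ψ.1 = (∏ L ∈ A, (e L).form) * C u := by
    have hhom : (φ.1 * ψ.2 - φ.2 * ψ.1).IsHomogeneous (A.card + 0) := by
      rw [add_zero, ← hd]
      exact (hφ.1.mul hψ.2.1).sub (hφ.2.1.mul hψ.1)
    obtain ⟨q, hq, h⟩ := exists_homogeneous_of_dvd hQ hhom (hdvd hφ' hψ')
    exact ⟨_, by rw [h, totalDegree_eq_zero_iff_eq_C.1 (Nat.le_zero.1 hq.totalDegree_le)]⟩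
  have hQ0 : ∏ L ∈ A, (e L).form ≠ 0 := fun h => hdet (by rw [hu, h, zero_mul])
  have hu0 : u ≠ 0 := fun h => hdet (by rw [hu, h, C_0, mul_zero])
  have huC : (C u⁻¹ * C u : MvPolynomial (Fin 3) K) = 1 := by
    rw [← C_mul, inv_mul_cancel₀ hu0, C_1]
  obtain ⟨hθ1, g, hg⟩ := hθ
  rw [applyDer3_X_two] at hg
  obtain ⟨ω, hω1, hω2⟩ : ∃ ω : MvPolynomial (Fin 3) K × MvPolynomial (Fin 3) K,
      ω.1 = θ 0 - g * X 0 ∧ ω.2 = θ 1 - g * X 1 := ⟨(_, _), rfl, rfl⟩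
  have hω : ∀ L ∈ A, (e L).form ∣ (e L).normal ω := by
    intro L hL
    obtain ⟨q, hq⟩ := hθ1 L hL (e L).a (e L).b (e L).c (e L).ne_zero (he L hL).symm
    have hlin : lin3 (e L).a (e L).b (e L).c =
      C (e L).a * X 0 + C (e L).b * X 1 + C (e L).c * X 2 := rfl
    rw [applyDer3_lin3, hg] at hq
    refine ⟨q - g, ?_⟩
    rw [PLine.normal_apply, PLine.form, hω1, hω2]
    linear_combination hq + g * hlin
  obtain ⟨p, hp⟩ := hdvd hω hψ'
  obtain ⟨q, hq⟩ := hdvd hφ' hω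
  have hQu : (φ.1 * ψ.2 - φ.2 * ψ.1) * C u⁻¹ = ∏ L ∈ A, (e L).form := by
    linear_combination C u⁻¹ * hu + (∏ L ∈ A, (e L).form) * huC
  have h0 : ω.1 = C u⁻¹ * p * φ.1 + C u⁻¹ * q * ψ.1 := by
    apply mul_left_cancel₀ hdet
    linear_combination φ.1 * hp + ψ.1 * hq - (p * φ.1 + q * ψ.1) * hQu
  have h1 : ω.2 = C u⁻¹ * p * φ.2 + C u⁻¹ * q * ψ.2 := by
    apply mul_left_cancel₀ hdet
    linear_combination φ.2 * hp + ψ.2 * hq - (p * φ.2 + q * ψ.2) * hQu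
  refine ⟨(g, C u⁻¹ * p, C u⁻¹ * q), ?_, ?_⟩
  · funext j
    fin_cases j
    · simp only [Fin.zero_eta, Matrix.cons_val_zero]
      linear_combination h0 - hω1
    · simp only [Fin.mk_one, Matrix.cons_val_one, Matrix.cons_val_zero]
      linear_combination h1 - hω2
    · simpa using hg
  · rintro ⟨y₀, y₁, y₂⟩ hy
    have e0 : θ 0 = y₀ * X 0 + y₁ * φ.1 + y₂ * ψ.1 := congrFun hy 0
    have e1 : θ 1 = y₀ * X 1 + y₁ * φ.2 + y₂ * ψ.2 := congrFun hy 1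
    have e2 : θ 2 = y₀ * X 2 + y₁ * 0 + y₂ * 0 := congrFun hy 2
    have hy₀ : y₀ = g := by
      apply mul_right_cancel₀ (X_ne_zero (R := K) (2 : Fin 3))
      linear_combination hg - e2
    subst hy₀
    have hy₁ : y₁ = C u⁻¹ * p := by
      apply mul_left_cancel₀ hdet
      linear_combination ψ.2 * (h0 - hω1 - e0) - ψ.1 * (h1 - hω2 - e1)
    have hy₂ : y₂ = C u⁻¹ * q := by
      apply mul_left_cancel₀ hdet
      linear_combination φ.1 * (h1 - hω2 - e1) - φ.2 * (h0 - hω1 - e0)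
    rw [hy₁, hy₂]

theorem card_and_b2_of_chi {F : Type*} {A : Finset (Set (F × F))} {a b : ℕ}
    (h : ∀ t : ℂ, chi A t = (t - (a : ℂ)) * (t - (a : ℂ) - (b : ℂ))) :
    A.card = a + (a + b) ∧ b2 A = a * (a + b) := by
  have h0 := h 0
  have h1 := h 1
  unfold chi at h0 h1
  constructor
  · have : (A.card : ℂ) = (a + (a + b) : ℕ) := by
      push_cast
      linear_combination h0 - h1
    exact_mod_cast this
  · have : (b2 A : ℂ) = (a * (a + b) : ℤ) := by
      push_cast
      linear_combination h0
    exact_mod_cast this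

open Classical in
theorem PLine.det_ne_zero {A : Finset (Set (K × K))} {l : PLine K} {d : ℕ}
    {φ ψ : MvPolynomial (Fin 3) K × MvPolynomial (Fin 3) K}
    (hφ : φ ∈ logFields (insert l.set A) d) (hφ0 : l.resTangent φ ≠ 0)
    (hψ0 : l.resNormal ψ ≠ 0) : φ.1 * ψ.2 - φ.2 * ψ.1 ≠ 0 := by
  intro h
  obtain ⟨h1, h2⟩ := PLine.resTangent_formulas hφ
  have h3 := congrArg l.res h
  rw [map_sub, map_mul, map_mul, h1, h2, map_zero] at h3
  refine mul_ne_zero hφ0 hψ0 ?_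
  rw [PLine.resNormal_apply, PLine.normal_apply, map_add, map_mul, map_mul, l.res_C, l.res_C]
  linear_combination -h3

open Classical in
theorem form_smul_mem_logFields_insert {A : Finset (Set (K × K))} {l : PLine K} {d : ℕ}
    {ψ : MvPolynomial (Fin 3) K × MvPolynomial (Fin 3) K} (hψ : ψ ∈ logFields A d) :
    (l.form * ψ.1, l.form * ψ.2) ∈ logFields (insert l.set A) (d + 1) := by
  have hn (m : PLine K) : m.normal (l.form * ψ.1, l.form * ψ.2) = l.form * m.normal ψ := by
    rw [PLine.normal_apply, PLine.normal_apply]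
    ring
  refine ⟨?_, ?_, fun m hm => ?_⟩
  · rw [add_comm]
    exact l.form_homogeneous.mul hψ.1
  · rw [add_comm]
    exact l.form_homogeneous.mul hψ.2.1
  · rw [hn]
    rcases Finset.mem_insert.1 hm with hm | hm
    · exact (PLine.form_dvd_of_set_eq hm).mul_right _
    · exact (hψ.2.2 m hm).mul_left _

/-- **Theorem 1.1 (3)**. If `χ(C,t) = (t−a)(t−a−b)` with `a, b ∈ ℤ_{≥0}` and there is a
line `H` (in `C` or not) with `|C ∩ H| = a` or `|C ∩ H| = a + b`, then `C` is free. -/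
theorem free_of_line_with_nH_eq_root
    {K : Type*} [Field K] (C : Finset (Set (K × K))) (hC : IsLineArr C)
    (a b : ℕ)
    (hchi : ∀ t : ℂ, chi C t = (t - (a : ℂ)) * (t - (a : ℂ) - (b : ℂ)))
    (H : Set (K × K)) (hH : IsAffineLine H)
    (hn : nOn C H = a ∨ nOn C H = a + b) :
    IsFree C := by
  classical
  obtain ⟨hcard, hb2⟩ := card_and_b2_of_chi hchi
  obtain ⟨l, rfl⟩ := PLine.exists_set_eq hH
  by_cases hl : l.set ∈ C
  · obtain ⟨A, hlA, rfl⟩ : ∃ A, l.set ∉ A ∧ insert l.set A = C :=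
      ⟨C.erase l.set, Finset.notMem_erase _ _, Finset.insert_erase hl⟩
    have hA : IsLineArr A := fun L hL => hC L (Finset.mem_insert_of_mem hL)
    obtain ⟨e, he⟩ := exists_pline_section hA
    have hnOn : nOn (insert l.set A) l.set = (meets A e l).card := by
      rw [← nOn_eq_card_meets he hlA, nOn, nOn]
      congr 1
      ext p
      simp
    rw [b2_insert he hlA] at hb2
    rw [Finset.card_insert_of_notMem hlA] at hcard
    rw [hnOn] at hn
    have hle : (meets A e l).card ≤ A.card := card_meets_le
    have hb : b2 A = (meets A e l).card * ((A.card : ℤ) - (meets A e l).card) := by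
      zify at hcard hn
      rw [eq_sub_of_add_eq hb2, eq_sub_of_add_eq hcard]
      rcases hn with hn | hn <;> rw [hn] <;> ring
    obtain ⟨⟨φ, hφ, hφ0⟩, ψ, hψ, hψ0⟩ := exists_logFields_ne_zero he hlA hb
    refine ⟨_, _, isFreeExp_of_det_ne_zero hC hφ (form_smul_mem_logFields_insert hψ) ?_ ?_⟩
    · rw [Finset.card_insert_of_notMem hlA]
      lia
    · have := mul_ne_zero l.form_ne_zero (PLine.det_ne_zero hφ hφ0 hψ0)
      intro h
      exact this (by linear_combination h)
  · obtain ⟨e, he⟩ := exists_pline_section hC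
    rw [nOn_eq_card_meets he hl] at hn
    have hle : (meets C e l).card ≤ C.card := card_meets_le
    have hb : b2 C = (meets C e l).card * ((C.card : ℤ) - (meets C e l).card) := by
      zify at hcard hn
      rw [hb2, hcard]
      rcases hn with hn | hn <;> rw [hn] <;> ring
    obtain ⟨⟨φ, hφ, hφ0⟩, ψ, hψ, hψ0⟩ := exists_logFields_ne_zero he hl hb
    exact ⟨_, _, isFreeExp_of_det_ne_zero hC (logFields_anti (Finset.subset_insert _ _) _ hφ) hψ
      (by lia) (PLine.det_ne_zero hφ hφ0 hψ0)⟩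
end

section
/- Let K be a field of arbitrary characteristic and let A be an affine line arrangement in K² such that |A| = 2n + r with n, r ∈ ℤ_{≥0} and χ(A,t) = (t − n)(t − n − r). Assume that A contains a free subarrangement B with exp₀(B) = (n − s, n − 1) for some s ≥ 1. Then A is free if and only if there is no arrangement C with B ⊆ C ⊆ A such that χ(C,t) = (t − n − u + 1)(t − n + s) for some u > r + 1. -/
open MvPolynomial

variable {K : Type*} [Field K]

/-- Factoring a homogeneous polynomial by a homogeneous factor leaves a homogeneous factor. -/
theorem MvPolynomial.IsHomogeneous.of_mul_right {p q : MvPolynomial (Fin 3) K} {m e : ℕ}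
    (hq : q.IsHomogeneous e) (hq0 : q ≠ 0) (h : (p * q).IsHomogeneous (m + e)) :
    p.IsHomogeneous m := by
  let _ := MvPolynomial.gradedAlgebra (σ := Fin 3) (R := K)
  have h1 := DirectSum.coe_decompose_mul_of_right_mem_of_le (homogeneousSubmodule (Fin 3) K)
    (a := p) (b := q) (i := e) (n := m + e) hq (by omega)
  rw [DirectSum.decompose_of_mem_same _ h, Nat.add_sub_cancel] at h1
  rw [mul_right_cancel₀ hq0 h1]
  exact (DirectSum.decompose (homogeneousSubmodule (Fin 3) K) p m).2

/-- A multiple of a nonzero form of larger degree vanishes. -/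
theorem MvPolynomial.IsHomogeneous.eq_zero_of_dvd {f q : MvPolynomial (Fin 3) K} {m e : ℕ}
    (hf : f.IsHomogeneous m) (hq : q.IsHomogeneous e) (hdvd : q ∣ f) (hlt : m < e) : f = 0 := by
  by_contra hne
  obtain ⟨g, rfl⟩ := hdvd
  have h1 := hf.totalDegree hne
  have hq0 : q ≠ 0 := left_ne_zero_of_mul hne
  rw [totalDegree_mul_of_isDomain hq0 (right_ne_zero_of_mul hne), hq.totalDegree hq0] at h1
  omega

/-- The equation `a * x + b * y + c = 0` of an affine line, together with a vector `(u, v)` on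
which its linear part takes the value `1`. -/
structure LineEq (K : Type*) [Field K] where
  a : K
  b : K
  c : K
  u : K
  v : K
  unit : a * u + b * v = 1

instance : Nonempty (LineEq K) := ⟨⟨1, 0, 0, 1, 0, by simp⟩⟩

namespace LineEq

variable (e e' : LineEq K)

/-- The line defined by an equation. -/
def carrier : Set (K × K) := {p | e.a * p.1 + e.b * p.2 + e.c = 0}

/-- The linear form defining the cone of the line. -/
noncomputable def form : MvPolynomial (Fin 3) K := lin3 e.a e.b e.c

/-- The value on the defining form of the derivation `F ∂ₓ + G ∂_y`. -/
noncomputable def act (F G : MvPolynomial (Fin 3) K) : MvPolynomial (Fin 3) K :=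
  C e.a * F + C e.b * G

/-- A linear parametrization of the line. -/
def param (t : K) : K × K := (-(e.c * e.u) - e.b * t, -(e.c * e.v) + e.a * t)

/-- The linear form restricting to the parameter of the line. -/
noncomputable def par : MvPolynomial (Fin 3) K := C (-e.v) * X 0 + C e.u * X 1

/-- The projection of the polynomial ring onto forms in `par` and `z`. -/
noncomputable def proj : MvPolynomial (Fin 3) K →ₐ[K] MvPolynomial (Fin 3) K :=
  aeval ![C (-(e.c * e.u)) * X 2 - C e.b * e.par, C (-(e.c * e.v)) * X 2 + C e.a * e.par, X 2]

/-- Restriction of polynomials to the affine line `z = 1` in the plane of the cone. -/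
noncomputable def restr : MvPolynomial (Fin 3) K →ₐ[K] Polynomial K :=
  aeval ![Polynomial.C (-(e.c * e.u)) - Polynomial.C e.b * Polynomial.X,
    Polynomial.C (-(e.c * e.v)) + Polynomial.C e.a * Polynomial.X, 1]

theorem ne_zero : e.a ≠ 0 ∨ e.b ≠ 0 := by
  by_contra! h
  have := e.unit
  simp [h.1, h.2] at this

theorem form_homog : e.form.IsHomogeneous 1 :=
  ((isHomogeneous_C_mul_X _ _).add (isHomogeneous_C_mul_X _ _)).add (isHomogeneous_C_mul_X _ _)

theorem form_ne_zero : e.form ≠ 0 := by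
  intro h
  have h2 : eval ![e.u, e.v, 0] e.form = 1 := by simp [form, lin3, e.unit]
  rw [h] at h2
  simp at h2

theorem unit_C : C e.a * C e.u + C e.b * C e.v = (1 : MvPolynomial (Fin 3) K) := by
  rw [← C_mul, ← C_mul, ← C_add, e.unit, C_1]

theorem form_dvd_sub_proj (f : MvPolynomial (Fin 3) K) : e.form ∣ f - e.proj f := by
  rw [← Ideal.mem_span_singleton, ← Ideal.Quotient.eq]
  have : (Ideal.Quotient.mkₐ K (Ideal.span {e.form})) =
      (Ideal.Quotient.mkₐ K (Ideal.span {e.form})).comp e.proj := by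
    apply MvPolynomial.algHom_ext
    intro i
    simp only [AlgHom.comp_apply, Ideal.Quotient.mkₐ_eq_mk]
    rw [Ideal.Quotient.eq, Ideal.mem_span_singleton]
    have hu := e.unit_C
    fin_cases i
    · refine ⟨C e.u, ?_⟩
      simp [proj, form, lin3, par]
      linear_combination (-X 0 : MvPolynomial (Fin 3) K) * hu
    · refine ⟨C e.v, ?_⟩
      simp [proj, form, lin3, par]
      linear_combination (-X 1 : MvPolynomial (Fin 3) K) * hu
    · simp [proj]
  exact DFunLike.congr_fun this f

theorem proj_form : e.proj e.form = 0 := by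
  have hu := e.unit_C
  simp [proj, form, lin3, par]
  linear_combination -(C e.c * X 2 : MvPolynomial (Fin 3) K) * hu

theorem form_dvd_iff_proj (f : MvPolynomial (Fin 3) K) : e.form ∣ f ↔ e.proj f = 0 := by
  constructor
  · rintro ⟨g, rfl⟩
    rw [map_mul, proj_form, zero_mul]
  · intro h
    simpa [h] using e.form_dvd_sub_proj f

theorem form_prime : Prime e.form := by
  refine ⟨e.form_ne_zero, fun h => ?_, fun f g h => ?_⟩
  · have := h.map e.proj
    rw [proj_form] at this
    exact not_isUnit_zero this
  · rw [form_dvd_iff_proj, map_mul] at h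
    rw [form_dvd_iff_proj, form_dvd_iff_proj]
    exact mul_eq_zero.mp h

theorem restr_form : e.restr e.form = 0 := by
  have hu : Polynomial.C e.a * Polynomial.C e.u + Polynomial.C e.b * Polynomial.C e.v =
      (1 : Polynomial K) := by
    rw [← Polynomial.C_mul, ← Polynomial.C_mul, ← Polynomial.C_add, e.unit, Polynomial.C_1]
  simp [restr, form, lin3]
  linear_combination -(Polynomial.C e.c) * hu

theorem eq_zero_of_dvd_restr {f : MvPolynomial (Fin 3) K} (h : e.form ∣ f) : e.restr f = 0 := by
  obtain ⟨g, rfl⟩ := h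
  rw [map_mul, restr_form, zero_mul]

theorem restr_par : e.restr e.par = Polynomial.X := by
  have hu : Polynomial.C e.a * Polynomial.C e.u + Polynomial.C e.b * Polynomial.C e.v =
      (1 : Polynomial K) := by
    rw [← Polynomial.C_mul, ← Polynomial.C_mul, ← Polynomial.C_add, e.unit, Polynomial.C_1]
  simp [restr, par]
  linear_combination (Polynomial.X) * hu

theorem par_homog : e.par.IsHomogeneous 1 :=
  (isHomogeneous_C_mul_X _ _).add (isHomogeneous_C_mul_X _ _)

theorem _root_.MvPolynomial.IsHomogeneous.aeval_mul {L : Type*} [Field L] [Algebra K L]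
    {f : MvPolynomial (Fin 3) K} {d : ℕ} (hf : f.IsHomogeneous d) (z : L) (y : Fin 3 → L) :
    aeval (fun i => z * y i) f = z ^ d * aeval y f := by
  rw [aeval_def, aeval_def, eval₂_eq, eval₂_eq, Finset.mul_sum]
  refine Finset.sum_congr rfl fun s hs => ?_
  simp_rw [mul_pow]
  rw [Finset.prod_mul_distrib, Finset.prod_pow_eq_pow_sum,
    ← MvPolynomial.IsHomogeneous.degree_eq_sum_deg_support hf hs]
  ring

/-- A form vanishing on an affine line is divisible by the equation of its cone. -/
theorem form_dvd_of_restr {f : MvPolynomial (Fin 3) K} {d : ℕ} (hf : f.IsHomogeneous d)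
    (h : e.restr f = 0) : e.form ∣ f := by
  rw [form_dvd_iff_proj]
  let L := FractionRing (MvPolynomial (Fin 3) K)
  apply IsFractionRing.injective (MvPolynomial (Fin 3) K) L
  rw [map_zero]
  set z : L := algebraMap (MvPolynomial (Fin 3) K) L (X 2) with hz
  have hz0 : z ≠ 0 := by
    rw [hz, Ne, IsFractionRing.to_map_eq_zero_iff]
    exact X_ne_zero 2
  set t : L := algebraMap _ L e.par / z with ht
  have htz : z * t = algebraMap _ L e.par := mul_div_cancel₀ _ hz0
  let y : Fin 3 → L := ![algebraMap K L (-(e.c * e.u)) - algebraMap K L e.b * t,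
    algebraMap K L (-(e.c * e.v)) + algebraMap K L e.a * t, 1]
  have hC : ∀ k : K, algebraMap (MvPolynomial (Fin 3) K) L (C k) = algebraMap K L k := fun k => by
    rw [IsScalarTower.algebraMap_apply K (MvPolynomial (Fin 3) K) L]; rfl
  have h1 : (IsScalarTower.toAlgHom K (MvPolynomial (Fin 3) K) L).comp e.proj =
      aeval (fun i => z * y i) := by
    apply MvPolynomial.algHom_ext
    intro i
    fin_cases i
    · simp only [AlgHom.comp_apply, proj, aeval_X, y, IsScalarTower.coe_toAlgHom']
      simp [hC, ← htz, ← hz]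
      ring
    · simp only [AlgHom.comp_apply, proj, aeval_X, y, IsScalarTower.coe_toAlgHom']
      simp [hC, ← htz, ← hz]
      ring
    · simp [proj, y, hz]
  have h2 : (Polynomial.aeval t).comp e.restr = aeval y := by
    apply MvPolynomial.algHom_ext
    intro i
    fin_cases i <;> simp [restr, y]
  have h3 := DFunLike.congr_fun h1 f
  have h4 := DFunLike.congr_fun h2 f
  simp only [AlgHom.comp_apply, h, map_zero] at h4
  rw [hf.aeval_mul, ← h4, mul_zero] at h3
  exact h3

theorem natDegree_restr_le (f : MvPolynomial (Fin 3) K) :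
    (e.restr f).natDegree ≤ f.totalDegree := by
  have := aeval_natDegree_le f le_rfl
    ![Polynomial.C (-(e.c * e.u)) - Polynomial.C e.b * Polynomial.X,
    Polynomial.C (-(e.c * e.v)) + Polynomial.C e.a * Polynomial.X, 1] (n := 1) (by
      intro i
      fin_cases i
      · exact (Polynomial.natDegree_sub_le _ _).trans
          (max_le ((Polynomial.natDegree_C _).trans_le zero_le_one)
            ((Polynomial.natDegree_C_mul_le _ _).trans (by simp)))
      · exact (Polynomial.natDegree_add_le _ _).trans
          (max_le ((Polynomial.natDegree_C _).trans_le zero_le_one)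
            ((Polynomial.natDegree_C_mul_le _ _).trans (by simp)))
      · simp)
  simpa [restr] using this

theorem eval_restr (f : MvPolynomial (Fin 3) K) (t : K) :
    (e.restr f).eval t = eval ![(e.param t).1, (e.param t).2, 1] f := by
  have : (Polynomial.aeval t).comp e.restr = aeval ![(e.param t).1, (e.param t).2, 1] := by
    apply MvPolynomial.algHom_ext
    intro i
    fin_cases i <;> simp [restr, param]
  have h2 := DFunLike.congr_fun this f
  rw [AlgHom.comp_apply, Polynomial.coe_aeval_eq_eval] at h2
  exact h2

theorem act_homog {F G : MvPolynomial (Fin 3) K} {d : ℕ} (hF : F.IsHomogeneous d)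
    (hG : G.IsHomogeneous d) : (e.act F G).IsHomogeneous d :=
  (hF.C_mul _).add (hG.C_mul _)

/-- Every univariate polynomial is the restriction of a form. -/
theorem exists_restr_eq (p : Polynomial K) {d : ℕ} (hd : p.natDegree ≤ d) :
    ∃ E : MvPolynomial (Fin 3) K, E.IsHomogeneous d ∧ e.restr E = p := by
  refine ⟨∑ j ∈ Finset.range (d + 1), C (p.coeff j) * (e.par ^ j * X 2 ^ (d - j)), ?_, ?_⟩
  · refine IsHomogeneous.sum _ _ _ fun j hj => ?_
    have h := ((e.par_homog.pow j).mul (isHomogeneous_X_pow (R := K) (2 : Fin 3) (d - j))).C_mul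
      (p.coeff j)
    have hjd : 1 * j + (d - j) = d := by
      have := Finset.mem_range.mp hj
      omega
    rwa [hjd] at h
  · have h2 : e.restr (X 2) = 1 := by simp [restr]
    rw [map_sum]
    conv_rhs => rw [p.as_sum_range' (d + 1) (by omega)]
    refine Finset.sum_congr rfl fun j _ => ?_
    rw [map_mul, map_mul, map_pow, map_pow, restr_par, h2, one_pow, mul_one,
      ← Polynomial.C_mul_X_pow_eq_monomial]
    congr 1
    exact e.restr.commutes _

end LineEq

namespace LineEq

variable (e e' : LineEq K)

/-- The determinant of the linear parts of two line equations. -/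
def cross : K := e.a * e'.b - e.b * e'.a

/-- The value of one equation at the origin of the parametrization of another line. -/
def offset : K := e'.a * (-(e.c * e.u)) + e'.b * (-(e.c * e.v)) + e'.c

theorem param_mem_iff (t : K) : e.param t ∈ e'.carrier ↔ e.cross e' * t + e.offset e' = 0 := by
  have : e'.a * (e.param t).1 + e'.b * (e.param t).2 + e'.c = e.cross e' * t + e.offset e' := by
    simp only [param, cross, offset]
    ring
  rw [← this]
  rfl

theorem param_mem (t : K) : e.param t ∈ e.carrier := by
  rw [param_mem_iff]
  simp only [cross, offset]
  linear_combination -e.c * e.unit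

theorem exists_param_eq {q : K × K} (hq : q ∈ e.carrier) : ∃ t, e.param t = q := by
  have hq' : e.a * q.1 + e.b * q.2 + e.c = 0 := hq
  refine ⟨-e.v * q.1 + e.u * q.2, Prod.ext ?_ ?_⟩
  · simp only [param]
    linear_combination -e.u * hq' + q.1 * e.unit
  · simp only [param]
    linear_combination -e.v * hq' + q.2 * e.unit

theorem a_eq (h : e.cross e' = 0) : e'.a = (e'.a * e.u + e'.b * e.v) * e.a := by
  simp only [cross] at h
  linear_combination -e'.a * e.unit - e.v * h

theorem b_eq (h : e.cross e' = 0) : e'.b = (e'.a * e.u + e'.b * e.v) * e.b := by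
  simp only [cross] at h
  linear_combination -e'.b * e.unit + e.u * h

theorem ratio_ne_zero (h : e.cross e' = 0) : e'.a * e.u + e'.b * e.v ≠ 0 := by
  intro h0
  have ha := e.a_eq e' h
  have hb := e.b_eq e' h
  rw [h0, zero_mul] at ha hb
  rcases e'.ne_zero with h1 | h1
  exacts [h1 ha, h1 hb]

theorem carrier_eq_of_cross (h : e.cross e' = 0) (h2 : e.offset e' = 0) :
    e.carrier = e'.carrier := by
  have ha := e.a_eq e' h
  have hb := e.b_eq e' h
  have h0 := e.ratio_ne_zero e' h
  have hc : e'.c = (e'.a * e.u + e'.b * e.v) * e.c := by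
    simp only [offset] at h2
    linear_combination h2
  ext p
  change e.a * p.1 + e.b * p.2 + e.c = 0 ↔ e'.a * p.1 + e'.b * p.2 + e'.c = 0
  have : e'.a * p.1 + e'.b * p.2 + e'.c =
      (e'.a * e.u + e'.b * e.v) * (e.a * p.1 + e.b * p.2 + e.c) := by
    linear_combination p.1 * ha + p.2 * hb + hc
  rw [this, mul_eq_zero, or_iff_right h0]

theorem cross_eq_zero_of_carrier_eq (h : e.carrier = e'.carrier) :
    e.cross e' = 0 ∧ e.offset e' = 0 := by
  have h0 := (e.param_mem_iff e' 0).mp (h ▸ e.param_mem 0)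
  have h1 := (e.param_mem_iff e' 1).mp (h ▸ e.param_mem 1)
  exact ⟨by linear_combination h1 - h0, by linear_combination h0⟩

theorem restr_form' : e.restr e'.form =
    Polynomial.C (e.cross e') * Polynomial.X + Polynomial.C (e.offset e') := by
  simp [restr, form, lin3, cross, offset]
  ring

theorem carrier_eq_of_form_dvd (h : e.form ∣ e'.form) : e.carrier = e'.carrier := by
  have h1 := e.eq_zero_of_dvd_restr h
  rw [restr_form'] at h1
  apply e.carrier_eq_of_cross
  · simpa using congrArg (fun p => Polynomial.coeff p 1) h1
  · simpa using congrArg (fun p => Polynomial.coeff p 0) h1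

theorem isRelPrime_form (h : e.carrier ≠ e'.carrier) : IsRelPrime e.form e'.form := by
  rw [e.form_prime.irreducible.isRelPrime_iff_not_dvd]
  exact fun hd => h (e.carrier_eq_of_form_dvd e' hd)

theorem cross_ne_zero_of_mem (h : e.carrier ≠ e'.carrier) {q : K × K} (h1 : q ∈ e.carrier)
    (h2 : q ∈ e'.carrier) : e.cross e' ≠ 0 := by
  intro h0
  obtain ⟨t, rfl⟩ := e.exists_param_eq h1
  rw [param_mem_iff, h0, zero_mul, zero_add] at h2
  exact h (e.carrier_eq_of_cross e' h0 h2)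

theorem root_restr_form {t : K} (h : e.param t ∈ e'.carrier) :
    Polynomial.X - Polynomial.C t ∣ e.restr e'.form := by
  rw [Polynomial.dvd_iff_isRoot, restr_form', Polynomial.IsRoot]
  simpa using (e.param_mem_iff e' t).mp h

end LineEq

theorem isAffineLine_iff (L : Set (K × K)) : IsAffineLine L ↔ ∃ e : LineEq K, L = e.carrier := by
  constructor
  · rintro ⟨a, b, c, h, rfl⟩
    by_cases ha : a = 0
    · have hb : b ≠ 0 := fun hb => h (by rw [ha, hb])
      exact ⟨⟨a, b, c, 0, b⁻¹, by simp [hb]⟩, rfl⟩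
    · exact ⟨⟨a, b, c, a⁻¹, 0, by simp [ha]⟩, rfl⟩
  · rintro ⟨e, rfl⟩
    refine ⟨e.a, e.b, e.c, fun h => ?_, rfl⟩
    rcases e.ne_zero with h1 | h1
    exacts [h1 (congrArg Prod.fst h), h1 (congrArg Prod.snd h)]

/-- A chosen equation of an affine line. -/
noncomputable def eqn (L : Set (K × K)) : LineEq K :=
  Classical.epsilon fun e => L = e.carrier

theorem carrier_eqn {L : Set (K × K)} (hL : IsAffineLine L) : (eqn L).carrier = L :=
  (Classical.epsilon_spec ((isAffineLine_iff L).mp hL)).symm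

/-- The derivation `F ∂ₓ + G ∂_y` is tangent to the cones of all lines of `A`. -/
def Tangent (A : Finset (Set (K × K))) (F G : MvPolynomial (Fin 3) K) : Prop :=
  ∀ L ∈ A, (eqn L).form ∣ (eqn L).act F G

/-- The product of the linear forms of the lines of `A`. -/
noncomputable def defPoly (A : Finset (Set (K × K))) : MvPolynomial (Fin 3) K :=
  ∏ L ∈ A, (eqn L).form

theorem defPoly_ne_zero (A : Finset (Set (K × K))) : defPoly A ≠ 0 :=
  Finset.prod_ne_zero_iff.mpr fun L _ => (eqn L).form_ne_zero

theorem defPoly_homog (A : Finset (Set (K × K))) : (defPoly A).IsHomogeneous A.card := by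
  have := IsHomogeneous.prod A (fun L => (eqn L).form) (fun _ => 1) fun L _ => (eqn L).form_homog
  simpa [defPoly] using this

theorem IsLineArr.carrier_ne {A : Finset (Set (K × K))} (hA : IsLineArr A) {L L' : Set (K × K)}
    (hL : L ∈ A) (hL' : L' ∈ A) (h : L ≠ L') : (eqn L).carrier ≠ (eqn L').carrier := by
  rwa [carrier_eqn (hA L hL), carrier_eqn (hA L' hL')]

theorem IsLineArr.defPoly_dvd {A : Finset (Set (K × K))} (hA : IsLineArr A)
    {f : MvPolynomial (Fin 3) K} (h : ∀ L ∈ A, (eqn L).form ∣ f) : defPoly A ∣ f :=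
  Finset.prod_dvd_of_isRelPrime
    (fun _ hL _ hL' hne => LineEq.isRelPrime_form _ _ (hA.carrier_ne hL hL' hne)) h

theorem IsLineArr.subset {A B : Finset (Set (K × K))} (hA : IsLineArr A) (h : B ⊆ A) :
    IsLineArr B := fun L hL => hA L (h hL)

theorem Tangent.subset {A B : Finset (Set (K × K))} {F G : MvPolynomial (Fin 3) K}
    (hA : Tangent A F G) (h : B ⊆ A) : Tangent B F G := fun L hL => hA L (h hL)

namespace LineEq

open Classical in
/-- If `m` lines other than `e` pass through a point of `e`, then the value on `e` of a derivation
tangent to them vanishes at that point to order `m - 1`. -/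
theorem pow_dvd_restr_act (e : LineEq K) (t : K) {A : Finset (Set (K × K))} (hA : IsLineArr A)
    (hmem : ∀ L ∈ A, e.param t ∈ L)
    {F G : MvPolynomial (Fin 3) K} (hFG : Tangent A F G) :
    (Polynomial.X - Polynomial.C t) ^ (A.card - 1) ∣ e.restr (e.act F G) := by
  rcases A.eq_empty_or_nonempty with rfl | ⟨L₀, hL₀⟩
  · simp
  set e₀ := eqn L₀ with he₀
  set q := e.param t with hq
  have hmem' : ∀ L ∈ A, q ∈ (eqn L).carrier := fun L hL => by
    rw [carrier_eqn (hA L hL)]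
    exact hmem L hL
  obtain ⟨g, hg⟩ := hFG L₀ hL₀
  rw [← he₀] at hg
  set F' := F - g * (X 0 - C q.1 * X 2) with hF'
  set G' := G - g * (X 1 - C q.2 * X 2) with hG'
  set f := -C e₀.v * F' + C e₀.u * G' with hf
  have hform : ∀ e₁ : LineEq K, q ∈ e₁.carrier → e₁.act F' G' = e₁.act F G - g * e₁.form := by
    intro e₁ h1
    have h2 : C e₁.a * C q.1 + C e₁.b * C q.2 + C e₁.c = (0 : MvPolynomial (Fin 3) K) := by
      rw [← C_mul, ← C_mul, ← C_add, ← C_add]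
      exact (congrArg C (show e₁.a * q.1 + e₁.b * q.2 + e₁.c = 0 from h1)).trans C_0
    simp only [act, form, lin3, F', G']
    linear_combination g * X 2 * h2
  have h0 : e₀.act F' G' = 0 := by
    rw [hform e₀ (hmem' L₀ hL₀), hg]
    ring
  have hu := e₀.unit_C
  have hFf : F' = -C e₀.b * f := by
    simp only [act] at h0
    rw [hf]
    linear_combination -F' * hu + C e₀.u * h0
  have hGf : G' = C e₀.a * f := by
    simp only [act] at h0
    rw [hf]
    linear_combination -G' * hu + C e₀.v * h0
  have hact : ∀ e₁ : LineEq K, e₁.act F' G' = C (e₀.cross e₁) * f := by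
    intro e₁
    simp only [act, cross, C_sub, C_mul]
    rw [hFf, hGf]
    ring
  have hdvd : ∀ L ∈ A.erase L₀, (eqn L).form ∣ f := by
    intro L hL
    obtain ⟨hne, hLA⟩ := Finset.mem_erase.mp hL
    have h1 : (eqn L).form ∣ C (e₀.cross (eqn L)) * f := by
      rw [← hact, hform _ (hmem' L hLA)]
      exact dvd_sub (hFG L hLA) (dvd_mul_left _ _)
    have h2 : e₀.cross (eqn L) ≠ 0 :=
      e₀.cross_ne_zero_of_mem _ (hA.carrier_ne hL₀ hLA hne.symm) (hmem' L₀ hL₀) (hmem' L hLA)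
    exact (IsUnit.dvd_mul_left ((isUnit_iff_ne_zero.mpr h2).map C)).mp h1
  have h3 : e.act F G = C (e₀.cross e) * f + g * e.form := by
    rw [← hact, hform e (e.param_mem t)]
    ring
  have h4 : defPoly (A.erase L₀) ∣ f := (hA.subset (A.erase_subset L₀)).defPoly_dvd hdvd
  rw [h3, map_add, map_mul, map_mul, restr_form, mul_zero, add_zero]
  refine Dvd.dvd.mul_left ?_ _
  refine dvd_trans ?_ (map_dvd e.restr h4)
  rw [defPoly, map_prod, ← Finset.card_erase_of_mem hL₀, ← Finset.prod_const]
  exact Finset.prod_dvd_prod_of_dvd _ _ fun L hL =>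
    e.root_restr_form _ (hmem' L (Finset.mem_of_mem_erase hL))

end LineEq

namespace LineEq

variable (e : LineEq K)

open Classical in
/-- The lines of `A` that are not parallel to `e`. -/
noncomputable def secants (A : Finset (Set (K × K))) : Finset (Set (K × K)) :=
  A.filter fun L => e.cross (eqn L) ≠ 0

/-- The parameter on `e` of the intersection point with `L`. -/
noncomputable def meetPar (L : Set (K × K)) : K := -e.offset (eqn L) / e.cross (eqn L)

open Classical in
/-- The parameters on `e` of the intersection points with the lines of `A`. -/
noncomputable def meets (A : Finset (Set (K × K))) : Finset K := (e.secants A).image e.meetPar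

open Classical in
/-- The lines of `A` meeting `e` exactly in the point with parameter `t`. -/
noncomputable def through (A : Finset (Set (K × K))) (t : K) : Finset (Set (K × K)) :=
  (e.secants A).filter fun L => e.meetPar L = t

/-- The polynomial dividing the restrictions to `e` of the values of tangent derivations. -/
noncomputable def meetPoly (A : Finset (Set (K × K))) : Polynomial K :=
  ∏ t ∈ e.meets A, (Polynomial.X - Polynomial.C t) ^ ((e.through A t).card - 1)

theorem meetPar_eq_iff {L : Set (K × K)} (hL : IsAffineLine L) (h : e.cross (eqn L) ≠ 0) (t : K) :
    e.meetPar L = t ↔ e.param t ∈ L := by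
  conv_rhs => rw [← carrier_eqn hL, param_mem_iff]
  rw [meetPar, div_eq_iff h]
  constructor <;> intro h1 <;> linear_combination -h1

theorem cross_ne_zero_of_param_mem {L : Set (K × K)} (hL : IsAffineLine L) (hne : L ≠ e.carrier)
    {t : K} (h : e.param t ∈ L) : e.cross (eqn L) ≠ 0 := by
  rw [← carrier_eqn hL] at h hne
  exact e.cross_ne_zero_of_mem _ hne.symm (e.param_mem t) h

theorem mem_through_iff {A : Finset (Set (K × K))} (hA : IsLineArr A) (he : e.carrier ∉ A) (t : K)
    (L : Set (K × K)) : L ∈ e.through A t ↔ L ∈ A ∧ e.param t ∈ L := by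
  simp only [through, secants, Finset.mem_filter]
  constructor
  · rintro ⟨⟨h1, h2⟩, h3⟩
    exact ⟨h1, (e.meetPar_eq_iff (hA L h1) h2 t).mp h3⟩
  · rintro ⟨h1, h2⟩
    have h3 := e.cross_ne_zero_of_param_mem (hA L h1) (fun h => he (h ▸ h1)) h2
    exact ⟨⟨h1, h3⟩, (e.meetPar_eq_iff (hA L h1) h3 t).mpr h2⟩

theorem mem_meets_iff {A : Finset (Set (K × K))} (hA : IsLineArr A) (he : e.carrier ∉ A) (t : K) :
    t ∈ e.meets A ↔ ∃ L ∈ A, e.param t ∈ L := by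
  simp only [← e.mem_through_iff hA he, meets, through, Finset.mem_image, Finset.mem_filter]

theorem card_meets_mono {A B : Finset (Set (K × K))} (h : A ⊆ B) :
    (e.meets A).card ≤ (e.meets B).card := by
  classical
  unfold meets secants
  exact Finset.card_le_card (Finset.image_subset_image (Finset.filter_subset_filter _ h))

theorem meetPoly_ne_zero (A : Finset (Set (K × K))) : e.meetPoly A ≠ 0 :=
  Finset.prod_ne_zero_iff.mpr fun _ _ => pow_ne_zero _ (Polynomial.X_sub_C_ne_zero _)

theorem natDegree_meetPoly (A : Finset (Set (K × K))) :
    (e.meetPoly A).natDegree + (e.meets A).card = (e.secants A).card := by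
  classical
  rw [meetPoly, Polynomial.natDegree_prod _ _ fun _ _ =>
    pow_ne_zero _ (Polynomial.X_sub_C_ne_zero _)]
  simp only [Polynomial.natDegree_pow, Polynomial.natDegree_X_sub_C, mul_one]
  rw [Finset.card_eq_sum_card_image e.meetPar (e.secants A), Finset.card_eq_sum_ones, meets,
    ← Finset.sum_add_distrib]
  refine Finset.sum_congr (by congr!) fun t ht => ?_
  obtain ⟨L, hL, rfl⟩ := Finset.mem_image.mp ht
  have : 0 < (e.through A (e.meetPar L)).card :=
    Finset.card_pos.mpr ⟨L, Finset.mem_filter.mpr ⟨hL, rfl⟩⟩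
  have h2 : (e.through A (e.meetPar L)).card =
    ((e.secants A).filter fun L' => e.meetPar L' = e.meetPar L).card := by
    rw [through]
  omega

theorem meetPoly_dvd {A : Finset (Set (K × K))} (hA : IsLineArr A) (he : e.carrier ∉ A)
    {F G : MvPolynomial (Fin 3) K} (hFG : Tangent A F G) :
    e.meetPoly A ∣ e.restr (e.act F G) := by
  refine Finset.prod_dvd_of_coprime (fun s _ t _ hst => ?_) fun t _ => ?_
  · exact (Polynomial.isCoprime_X_sub_C_of_isUnit_sub (sub_ne_zero.mpr hst).isUnit).pow
  · have hsub : e.through A t ⊆ A := fun L hL => ((e.mem_through_iff hA he t L).mp hL).1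
    exact e.pow_dvd_restr_act t (hA.subset hsub)
      (fun L hL => ((e.mem_through_iff hA he t L).mp hL).2) (hFG.subset hsub)

open Classical in
theorem natDegree_restr_act {A : Finset (Set (K × K))} (hA : IsLineArr A)
    {F G : MvPolynomial (Fin 3) K} (hFG : Tangent A F G) {k : ℕ} (hF : F.IsHomogeneous k)
    (hG : G.IsHomogeneous k) (h0 : e.restr (e.act F G) ≠ 0) :
    (e.restr (e.act F G)).natDegree + A.card ≤ k + (e.secants A).card := by
  set P := A.filter fun L => e.cross (eqn L) = 0 with hP
  have hPA : P ⊆ A := Finset.filter_subset _ _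
  have hcard : P.card + (e.secants A).card = A.card :=
    Finset.card_filter_add_card_filter_not _
  have hdvd : defPoly P ∣ e.act F G := by
    refine (hA.subset hPA).defPoly_dvd fun L hL => ?_
    obtain ⟨hLA, hcr⟩ := Finset.mem_filter.mp hL
    have h1 : (eqn L).act F G =
        C ((eqn L).a * e.u + (eqn L).b * e.v) * e.act F G := by
      have ha := congrArg (C (σ := Fin 3)) (e.a_eq _ hcr)
      have hb := congrArg (C (σ := Fin 3)) (e.b_eq _ hcr)
      rw [C_mul] at ha hb
      simp only [act]
      linear_combination F * ha + G * hb
    have h2 := hFG L hLA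
    rw [h1] at h2
    exact (IsUnit.dvd_mul_left
      ((isUnit_iff_ne_zero.mpr (e.ratio_ne_zero _ hcr)).map C)).mp h2
  obtain ⟨g, hg⟩ := hdvd
  have hact0 : e.act F G ≠ 0 := fun h => h0 (by rw [h, map_zero])
  have hg0 : g ≠ 0 := fun h => hact0 (by rw [hg, h, mul_zero])
  have hdeg := (e.act_homog hF hG).totalDegree hact0
  rw [hg, totalDegree_mul_of_isDomain (defPoly_ne_zero P) hg0,
    (defPoly_homog P).totalDegree (defPoly_ne_zero P)] at hdeg
  have hconst : (e.restr (defPoly P)).natDegree = 0 := by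
    rw [defPoly, map_prod]
    refine Nat.le_zero.mp ((Polynomial.natDegree_prod_le _ _).trans ?_)
    refine (Finset.sum_eq_zero fun L hL => ?_).le
    rw [restr_form', (Finset.mem_filter.mp hL).2]
    simp
  have h3 : (e.restr (e.act F G)).natDegree ≤ g.totalDegree := by
    rw [hg, map_mul]
    refine Polynomial.natDegree_mul_le.trans ?_
    rw [hconst, zero_add]
    exact e.natDegree_restr_le g
  omega

/-- The restriction to `e` of the value of a tangent derivation is a multiple of `meetPoly`, with
a cofactor of controlled degree. -/
theorem exists_restr_act_eq {A : Finset (Set (K × K))} (hA : IsLineArr A) (he : e.carrier ∉ A)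
    {F G : MvPolynomial (Fin 3) K} (hFG : Tangent A F G) {k : ℕ} (hF : F.IsHomogeneous k)
    (hG : G.IsHomogeneous k) :
    ∃ p : Polynomial K, e.restr (e.act F G) = e.meetPoly A * p ∧
      (p ≠ 0 → p.natDegree + A.card ≤ k + (e.meets A).card) := by
  obtain ⟨p, hp⟩ := e.meetPoly_dvd hA he hFG
  refine ⟨p, hp, fun hp0 => ?_⟩
  have h0 : e.restr (e.act F G) ≠ 0 := hp ▸ mul_ne_zero (e.meetPoly_ne_zero A) hp0
  have h1 := e.natDegree_restr_act hA hFG hF hG h0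
  have h2 := e.natDegree_meetPoly A
  rw [hp, Polynomial.natDegree_mul (e.meetPoly_ne_zero A) hp0] at h1
  omega

theorem card_le_of_restr_act_ne_zero {A : Finset (Set (K × K))} (hA : IsLineArr A)
    (he : e.carrier ∉ A) {F G : MvPolynomial (Fin 3) K} (hFG : Tangent A F G) {k : ℕ}
    (hF : F.IsHomogeneous k) (hG : G.IsHomogeneous k) (h0 : e.restr (e.act F G) ≠ 0) :
    A.card ≤ k + (e.meets A).card := by
  obtain ⟨p, hp, h⟩ := e.exists_restr_act_eq hA he hFG hF hG
  have hp0 : p ≠ 0 := by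
    rintro rfl
    exact h0 (by rw [hp, mul_zero])
  exact (Nat.le_add_left _ _).trans (h hp0)

/-- A derivation tangent to `A` and to `e` either vanishes on `e` or has degree at least the
number of intersection points on `e`. -/
theorem form_dvd_or_card_meets_le {A : Finset (Set (K × K))} (hA : IsLineArr A)
    (he : e.carrier ∉ A) {F G : MvPolynomial (Fin 3) K} (hFG : Tangent A F G) {k : ℕ}
    (hF : F.IsHomogeneous k) (hG : G.IsHomogeneous k) (h0 : e.restr (e.act F G) = 0) :
    (e.form ∣ F ∧ e.form ∣ G) ∨ (e.meets A).card ≤ k := by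
  have hroot : ∀ t ∈ e.meets A, (e.restr F).eval t = 0 ∧ (e.restr G).eval t = 0 := by
    intro t ht
    obtain ⟨L, hL, htL⟩ := (e.mem_meets_iff hA he t).mp ht
    have hcr := e.cross_ne_zero_of_param_mem (hA L hL) (fun h => he (h ▸ hL)) htL
    have h1 : (e.restr ((eqn L).act F G)).eval t = 0 := by
      obtain ⟨g, hg⟩ := hFG L hL
      rw [← carrier_eqn (hA L hL)] at htL
      rw [hg, map_mul, Polynomial.eval_mul,
        Polynomial.dvd_iff_isRoot.mp (e.root_restr_form _ htL), zero_mul]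
    have hE : ∀ e₁ : LineEq K, (e.restr (e₁.act F G)).eval t =
        e₁.a * (e.restr F).eval t + e₁.b * (e.restr G).eval t := by
      intro e₁
      simp only [eval_restr]
      simp [act]
    have h2 := hE e
    rw [h0, Polynomial.eval_zero] at h2
    rw [hE] at h1
    have hcr' : e.a * (eqn L).b - e.b * (eqn L).a ≠ 0 := hcr
    constructor
    · apply (mul_eq_zero.mp _).resolve_left hcr'
      linear_combination -(eqn L).b * h2 - e.b * h1
    · apply (mul_eq_zero.mp _).resolve_left hcr'
      linear_combination (eqn L).a * h2 + e.a * h1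
  have hcount : ∀ f : MvPolynomial (Fin 3) K, f.IsHomogeneous k → e.restr f ≠ 0 →
      (∀ t ∈ e.meets A, (e.restr f).eval t = 0) → (e.meets A).card ≤ k := by
    intro f hf hf0 h
    exact (Polynomial.card_le_degree_of_subset_roots fun t ht =>
      (Polynomial.mem_roots hf0).mpr (h t ht)).trans
      ((e.natDegree_restr_le f).trans hf.totalDegree_le)
  by_cases hF0 : e.restr F = 0
  · by_cases hG0 : e.restr G = 0
    · exact .inl ⟨e.form_dvd_of_restr hF hF0, e.form_dvd_of_restr hG hG0⟩
    · exact .inr (hcount G hG hG0 fun t ht => (hroot t ht).2)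
  · exact .inr (hcount F hF hF0 fun t ht => (hroot t ht).1)

end LineEq

theorem Tangent.defPoly_dvd_det {A : Finset (Set (K × K))} (hA : IsLineArr A)
    {F G F' G' : MvPolynomial (Fin 3) K} (h : Tangent A F G) (h' : Tangent A F' G') :
    defPoly A ∣ F * G' - F' * G := by
  refine hA.defPoly_dvd fun L hL => ?_
  have hu := (eqn L).unit_C
  have : F * G' - F' * G = (eqn L).act F G * (C (eqn L).u * G' - C (eqn L).v * F') +
      (eqn L).act F' G' * (C (eqn L).v * F - C (eqn L).u * G) := by
    simp only [LineEq.act]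
    linear_combination -(F * G' - F' * G) * hu
  rw [this]
  exact dvd_add ((h L hL).mul_right _) ((h' L hL).mul_right _)

/-- Saito's criterion, with homogeneous derivations annihilating `z`. -/
def SaitoFree (A : Finset (Set (K × K))) (d₁ d₂ : ℕ) : Prop :=
  ∃ F₁ G₁ F₂ G₂ : MvPolynomial (Fin 3) K,
    F₁.IsHomogeneous d₁ ∧ G₁.IsHomogeneous d₁ ∧ F₂.IsHomogeneous d₂ ∧ G₂.IsHomogeneous d₂ ∧
    Tangent A F₁ G₁ ∧ Tangent A F₂ G₂ ∧ ∃ c : K, c ≠ 0 ∧ F₁ * G₂ - F₂ * G₁ = C c * defPoly A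

theorem SaitoFree.symm {A : Finset (Set (K × K))} {d₁ d₂ : ℕ} (h : SaitoFree A d₁ d₂) :
    SaitoFree A d₂ d₁ := by
  obtain ⟨F₁, G₁, F₂, G₂, h1, h2, h3, h4, t1, t2, c, hc, hdet⟩ := h
  refine ⟨F₂, G₂, F₁, G₁, h3, h4, h1, h2, t2, t1, -c, neg_ne_zero.mpr hc, ?_⟩
  rw [C_neg]
  linear_combination -hdet

theorem SaitoFree.add_eq_card {A : Finset (Set (K × K))} {d₁ d₂ : ℕ} (h : SaitoFree A d₁ d₂) :
    d₁ + d₂ = A.card := by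
  obtain ⟨F₁, G₁, F₂, G₂, h1, h2, h3, h4, t1, t2, c, hc, hdet⟩ := h
  have h5 : (F₁ * G₂ - F₂ * G₁).IsHomogeneous (d₁ + d₂) := by
    refine (h1.mul h4).sub ?_
    rw [add_comm]
    exact h3.mul h2
  rw [hdet] at h5
  exact h5.inj_right ((defPoly_homog A).C_mul c)
    (mul_ne_zero (C_ne_zero.mpr hc) (defPoly_ne_zero A))

theorem applyDer3_X (θ : Fin 3 → MvPolynomial (Fin 3) K) (i : Fin 3) :
    applyDer3 θ (X i) = θ i := by
  simp [applyDer3, pderiv_X, Pi.single_apply]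

theorem inDCone_iff {A : Finset (Set (K × K))} (hA : IsLineArr A)
    (θ : Fin 3 → MvPolynomial (Fin 3) K) :
    InDCone A θ ↔ (∀ L ∈ A, (eqn L).form ∣ (eqn L).act (θ 0) (θ 1) + C (eqn L).c * θ 2) ∧
      X 2 ∣ θ 2 := by
  simp only [InDCone, applyDer3_lin3, applyDer3_X]
  refine and_congr ⟨fun h L hL => ?_, fun h L hL a b c hab hLe => ?_⟩
    ⟨fun ⟨g, h⟩ => ⟨g, by rw [h, mul_comm]⟩, fun ⟨g, h⟩ => ⟨g, by rw [h, mul_comm]⟩⟩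
  · obtain ⟨g, hg⟩ := h L hL (eqn L).a (eqn L).b (eqn L).c (fun h0 => by
      rcases (eqn L).ne_zero with h1 | h1
      exacts [h1 (congrArg Prod.fst h0), h1 (congrArg Prod.snd h0)]) (carrier_eqn (hA L hL)).symm
    exact ⟨g, by rw [LineEq.act, hg, mul_comm]; rfl⟩
  · obtain ⟨e', rfl, rfl, rfl⟩ : ∃ e' : LineEq K, e'.a = a ∧ e'.b = b ∧ e'.c = c := by
      by_cases ha : a = 0
      · have hb : b ≠ 0 := fun hb => hab (by rw [ha, hb])
        exact ⟨⟨a, b, c, 0, b⁻¹, by simp [hb]⟩, rfl, rfl, rfl⟩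
      · exact ⟨⟨a, b, c, a⁻¹, 0, by simp [ha]⟩, rfl, rfl, rfl⟩
    have hcar : (eqn L).carrier = e'.carrier := (carrier_eqn (hA L hL)).trans hLe
    obtain ⟨h1, h2⟩ := (eqn L).cross_eq_zero_of_carrier_eq e' hcar
    have h3 := congrArg (C (σ := Fin 3)) ((eqn L).a_eq e' h1)
    have h4 := congrArg (C (σ := Fin 3)) ((eqn L).b_eq e' h1)
    have h5 : C (σ := Fin 3) e'.c =
        C ((e'.a * (eqn L).u + e'.b * (eqn L).v) * (eqn L).c) := by
      congr 1
      simp only [LineEq.offset] at h2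
      linear_combination h2
    rw [C_mul] at h3 h4 h5
    obtain ⟨g, hg⟩ := h L hL
    refine ⟨g, ?_⟩
    simp only [LineEq.act, LineEq.form, lin3] at hg ⊢
    rw [h3, h4, h5]
    linear_combination C (e'.a * (eqn L).u + e'.b * (eqn L).v) * hg

theorem inDCone_of_tangent {A : Finset (Set (K × K))} (hA : IsLineArr A)
    {F G : MvPolynomial (Fin 3) K} (h : Tangent A F G) : InDCone A ![F, G, 0] := by
  rw [inDCone_iff hA]
  exact ⟨fun L hL => by simpa using h L hL, by simp⟩

theorem tangent_of_inDCone {A : Finset (Set (K × K))} (hA : IsLineArr A)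
    {θ : Fin 3 → MvPolynomial (Fin 3) K} (h : InDCone A θ) {g : MvPolynomial (Fin 3) K}
    (hg : θ 2 = g * X 2) : Tangent A (θ 0 - g * X 0) (θ 1 - g * X 1) := by
  intro L hL
  have h1 := ((inDCone_iff hA θ).mp h).1 L hL
  have : (eqn L).act (θ 0 - g * X 0) (θ 1 - g * X 1) =
      (eqn L).act (θ 0) (θ 1) + C (eqn L).c * θ 2 - g * (eqn L).form := by
    rw [hg]
    simp only [LineEq.act, LineEq.form, lin3]
    ring
  rw [this]
  exact dvd_sub h1 (dvd_mul_left _ _)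

theorem exists_tangent_of_inDCone {A : Finset (Set (K × K))} (hA : IsLineArr A)
    {θ : Fin 3 → MvPolynomial (Fin 3) K} (h : InDCone A θ) {d : ℕ} (hd : HomogDer3 θ d) :
    ∃ g, θ 2 = g * X 2 ∧ (θ 0 - g * X 0).IsHomogeneous d ∧ (θ 1 - g * X 1).IsHomogeneous d := by
  obtain ⟨g, hg⟩ := ((inDCone_iff hA θ).mp h).2
  rw [mul_comm] at hg
  refine ⟨g, hg, ?_⟩
  have h2 := hd 2
  suffices ∀ i : Fin 3, (g * X i).IsHomogeneous d from
    ⟨(hd 0).sub (this 0), (hd 1).sub (this 1)⟩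
  intro i
  cases d with
  | zero =>
    have h0 := h2.eq_zero_of_dvd (isHomogeneous_X K (2 : Fin 3)) ⟨g, by rw [hg, mul_comm]⟩ one_pos
    rw [h0, eq_comm, mul_eq_zero, or_iff_left (X_ne_zero 2)] at hg
    rw [hg, zero_mul]
    exact isHomogeneous_zero _ _ _
  | succ d =>
    rw [hg] at h2
    exact ((isHomogeneous_X K (2 : Fin 3)).of_mul_right (X_ne_zero 2) h2).mul
      (isHomogeneous_X K i)

theorem SaitoFree.isFreeExp {A : Finset (Set (K × K))} (hA : IsLineArr A) {d₁ d₂ : ℕ}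
    (h : SaitoFree A d₁ d₂) : IsFreeExp A d₁ d₂ := by
  obtain ⟨F₁, G₁, F₂, G₂, h1, h2, h3, h4, t1, t2, c, hc, hdet⟩ := h
  have hh : ∀ {F G : MvPolynomial (Fin 3) K} {d : ℕ}, F.IsHomogeneous d → G.IsHomogeneous d →
      HomogDer3 ![F, G, 0] d := by
    intro F G d hF hG i
    fin_cases i
    exacts [hF, hG, isHomogeneous_zero _ _ _]
  refine ⟨![F₁, G₁, 0], ![F₂, G₂, 0], inDCone_of_tangent hA t1, inDCone_of_tangent hA t2,
    hh h1 h2, hh h3 h4, fun θ hθ => ?_⟩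
  obtain ⟨g, hg⟩ := ((inDCone_iff hA θ).mp hθ).2
  rw [mul_comm] at hg
  have ht := tangent_of_inDCone hA hθ hg
  obtain ⟨p, hp⟩ := ht.defPoly_dvd_det hA t2
  obtain ⟨q, hq⟩ := t1.defPoly_dvd_det hA ht
  have hcC : C c * C c⁻¹ = (1 : MvPolynomial (Fin 3) K) := by
    rw [← C_mul, mul_inv_cancel₀ hc, C_1]
  have hQ : C c * defPoly A ≠ 0 := mul_ne_zero (C_ne_zero.mpr hc) (defPoly_ne_zero A)
  refine ⟨(g, C c⁻¹ * p, C c⁻¹ * q), ?_, ?_⟩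
  · funext j
    fin_cases j
    · apply mul_left_cancel₀ hQ
      change C c * defPoly A * θ 0 =
        C c * defPoly A * (g * X 0 + C c⁻¹ * p * F₁ + C c⁻¹ * q * F₂)
      linear_combination -(defPoly A * p * F₁ + defPoly A * q * F₂) * hcC
        + F₁ * hp + F₂ * hq - (θ 0 - g * X 0) * hdet
    · apply mul_left_cancel₀ hQ
      change C c * defPoly A * θ 1 =
        C c * defPoly A * (g * X 1 + C c⁻¹ * p * G₁ + C c⁻¹ * q * G₂)
      linear_combination -(defPoly A * p * G₁ + defPoly A * q * G₂) * hcC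
        + G₁ * hp + G₂ * hq - (θ 1 - g * X 1) * hdet
    · simp [hg]
  · rintro ⟨g', p', q'⟩ hθ'
    have e0 : θ 0 = g' * X 0 + p' * F₁ + q' * F₂ := congrFun hθ' 0
    have e1 : θ 1 = g' * X 1 + p' * G₁ + q' * G₂ := congrFun hθ' 1
    have e2 : θ 2 = g' * X 2 := by simpa using congrFun hθ' 2
    obtain rfl : g' = g := mul_right_cancel₀ (X_ne_zero (R := K) (2 : Fin 3)) (e2.symm.trans hg)
    rw [e0, e1] at hp hq
    refine Prod.ext rfl (Prod.ext ?_ ?_)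
    · apply mul_left_cancel₀ hQ
      change C c * defPoly A * p' = C c * defPoly A * (C c⁻¹ * p)
      linear_combination -(defPoly A * p) * hcC + hp - p' * hdet
    · apply mul_left_cancel₀ hQ
      change C c * defPoly A * q' = C c * defPoly A * (C c⁻¹ * q)
      linear_combination -(defPoly A * q) * hcC + hq - q' * hdet

theorem tangent_defPoly_mul (A : Finset (Set (K × K))) (F G : MvPolynomial (Fin 3) K) :
    Tangent A (defPoly A * F) (defPoly A * G) := by
  intro L hL
  have h : (eqn L).form ∣ defPoly A := Finset.dvd_prod_of_mem _ hL
  exact dvd_add ((h.mul_right F).mul_left _) ((h.mul_right G).mul_left _)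

open Classical in
theorem tangent_defPoly_erase (A : Finset (Set (K × K))) (L : Set (K × K)) :
    Tangent A (defPoly (A.erase L) * -C (eqn L).b) (defPoly (A.erase L) * C (eqn L).a) := by
  intro L' hL'
  by_cases h : L' = L
  · subst h
    simp only [LineEq.act]
    ring_nf
    exact dvd_zero _
  · exact tangent_defPoly_mul _ _ _ L' (Finset.mem_erase.mpr ⟨h, hL'⟩)

theorem IsFreeExp.saitoFree {A : Finset (Set (K × K))} (hA : IsLineArr A) {d₁ d₂ : ℕ}
    (h : IsFreeExp A d₁ d₂) : SaitoFree A d₁ d₂ := by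
  classical
  obtain ⟨θ₁, θ₂, c1, c2, hd1, hd2, hspan⟩ := h
  obtain ⟨g₁, hg1, hF1, hG1⟩ := exists_tangent_of_inDCone hA c1 hd1
  obtain ⟨g₂, hg2, hF2, hG2⟩ := exists_tangent_of_inDCone hA c2 hd2
  have t1 := tangent_of_inDCone hA c1 hg1
  have t2 := tangent_of_inDCone hA c2 hg2
  set F₁ := θ₁ 0 - g₁ * X 0 with hF₁
  set G₁ := θ₁ 1 - g₁ * X 1 with hG₁
  set F₂ := θ₂ 0 - g₂ * X 0 with hF₂
  set G₂ := θ₂ 1 - g₂ * X 1 with hG₂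
  have hgen : ∀ F G, Tangent A F G → ∃ p q, F = p * F₁ + q * F₂ ∧ G = p * G₁ + q * G₂ := by
    intro F G ht
    obtain ⟨⟨f, p, q⟩, hc, -⟩ := hspan _ (inDCone_of_tangent hA ht)
    have e0 : F = f * X 0 + p * θ₁ 0 + q * θ₂ 0 := congrFun hc 0
    have e1 : G = f * X 1 + p * θ₁ 1 + q * θ₂ 1 := congrFun hc 1
    have e2 : 0 = f * X 2 + p * θ₁ 2 + q * θ₂ 2 := congrFun hc 2
    have hf : f + p * g₁ + q * g₂ = 0 := by
      apply mul_right_cancel₀ (X_ne_zero (R := K) (2 : Fin 3))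
      rw [hg1, hg2] at e2
      linear_combination -e2
    exact ⟨p, q, by linear_combination e0 + X 0 * hf, by linear_combination e1 + X 1 * hf⟩
  obtain ⟨w, hw⟩ := t1.defPoly_dvd_det hA t2
  have hdvd : ∀ F G F' G', Tangent A F G → Tangent A F' G' →
      defPoly A * w ∣ F * G' - F' * G := by
    intro F G F' G' ht ht'
    obtain ⟨p, q, rfl, rfl⟩ := hgen F G ht
    obtain ⟨p', q', rfl, rfl⟩ := hgen F' G' ht'
    exact ⟨p * q' - p' * q, by linear_combination (p * q' - p' * q) * hw⟩
  have hQ := defPoly_ne_zero A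
  have hwQ : w ∣ defPoly A := by
    have := hdvd _ _ _ _ (tangent_defPoly_mul A 1 0) (tangent_defPoly_mul A 0 1)
    rw [← mul_dvd_mul_iff_left hQ]
    convert this using 1
    ring
  have hw0 : w ≠ 0 := ne_zero_of_dvd_ne_zero hQ hwQ
  have hwe : ∀ L, w ∣ defPoly (A.erase L) := by
    intro L
    have := hdvd _ _ _ _ (tangent_defPoly_erase A L)
      (tangent_defPoly_mul A (C (eqn L).u) (C (eqn L).v))
    rw [← mul_dvd_mul_iff_left hQ, ← dvd_neg]
    convert this using 1
    linear_combination defPoly A * defPoly (A.erase L) * (eqn L).unit_C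
  have hunit : IsUnit w := by
    by_contra hnu
    obtain ⟨π, hirr, hπ⟩ := WfDvdMonoid.exists_irreducible_factor hnu hw0
    obtain ⟨L, hL, hπL⟩ := hirr.prime.exists_mem_finset_dvd (hπ.trans hwQ)
    have h1 : (eqn L).form ∣ defPoly (A.erase L) :=
      ((hirr.dvd_symm (eqn L).form_prime.irreducible hπL).trans hπ).trans (hwe L)
    obtain ⟨L', hL', h2⟩ := (eqn L).form_prime.exists_mem_finset_dvd h1
    obtain ⟨hne, hL'A⟩ := Finset.mem_erase.mp hL'
    exact hA.carrier_ne hL hL'A hne.symm ((eqn L).carrier_eq_of_form_dvd _ h2)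
  obtain ⟨c, hc, rfl⟩ := MvPolynomial.isUnit_iff_eq_C_of_isReduced.mp hunit
  exact ⟨F₁, G₁, F₂, G₂, hF1, hG1, hF2, hG2, t1, t2, c, hc.ne_zero, by rw [hw, mul_comm]⟩

namespace LineEq

variable (e : LineEq K)

theorem form_dvd_det {F G F' G' : MvPolynomial (Fin 3) K} (h : e.form ∣ e.act F G)
    (h' : e.form ∣ e.act F' G') : e.form ∣ F * G' - F' * G := by
  have hu := e.unit_C
  have : F * G' - F' * G = e.act F G * (C e.u * G' - C e.v * F') +
      e.act F' G' * (C e.v * F - C e.u * G) := by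
    simp only [LineEq.act]
    linear_combination -(F * G' - F' * G) * hu
  rw [this]
  exact dvd_add (h.mul_right _) (h'.mul_right _)

theorem not_form_dvd {A : Finset (Set (K × K))} (hA : IsLineArr A) (he : e.carrier ∉ A) {c : K}
    (hc : c ≠ 0) : ¬ e.form ∣ C c * defPoly A := by
  intro h
  rw [IsUnit.dvd_mul_left ((isUnit_iff_ne_zero.mpr hc).map C)] at h
  obtain ⟨L, hL, h2⟩ := e.form_prime.exists_mem_finset_dvd h
  apply he
  rwa [e.carrier_eq_of_form_dvd _ h2, carrier_eqn (hA L hL)]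

theorem form_dvd_act_of_restr {F G : MvPolynomial (Fin 3) K} {k : ℕ} (hF : F.IsHomogeneous k)
    (hG : G.IsHomogeneous k) (h : e.restr (e.act F G) = 0) : e.form ∣ e.act F G :=
  e.form_dvd_of_restr (e.act_homog hF hG) h

end LineEq

/-- The number of intersection points on `H` with the lines of `A`, for a line `H` not in `A`. -/
noncomputable def numMeets (A : Finset (Set (K × K))) (H : Set (K × K)) : ℕ :=
  ((eqn H).meets A).card

theorem SaitoFree.numMeets_eq {A : Finset (Set (K × K))} {d₁ d₂ : ℕ} (h : SaitoFree A d₁ d₂)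
    (hA : IsLineArr A) {H : Set (K × K)} (hH : IsAffineLine H) (hHA : H ∉ A)
    (hlt : numMeets A H < d₂) : numMeets A H = d₁ := by
  have hcard := h.add_eq_card
  obtain ⟨F₁, G₁, F₂, G₂, h1, h2, h3, h4, t1, t2, c, hc, hdet⟩ := h
  rw [numMeets] at *
  set e := eqn H
  have he : e.carrier ∉ A := by rwa [carrier_eqn hH]
  have hnd := e.not_form_dvd hA he hc
  rw [← hdet] at hnd
  by_cases r1 : e.restr (e.act F₁ G₁) = 0
  · by_cases r2 : e.restr (e.act F₂ G₂) = 0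
    · exact absurd (e.form_dvd_det (e.form_dvd_act_of_restr h1 h2 r1)
        (e.form_dvd_act_of_restr h3 h4 r2)) hnd
    · have h5 := e.card_le_of_restr_act_ne_zero hA he t2 h3 h4 r2
      rcases e.form_dvd_or_card_meets_le hA he t1 h1 h2 r1 with ⟨h6, h7⟩ | h6
      · exact absurd (dvd_sub (h6.mul_right _) (h7.mul_left _)) hnd
      · omega
  · have := e.card_le_of_restr_act_ne_zero hA he t1 h1 h2 r1
    omega

theorem SaitoFree.le_numMeets {A : Finset (Set (K × K))} {d₁ d₂ : ℕ} (h : SaitoFree A d₁ d₂)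
    (hA : IsLineArr A) {H : Set (K × K)} (hH : IsAffineLine H) (hHA : H ∉ A)
    (hne : numMeets A H ≠ d₁) : d₂ ≤ numMeets A H := by
  by_contra hlt
  exact hne (h.numMeets_eq hA hH hHA (not_le.mp hlt))

open Classical in
theorem tangent_insert {A : Finset (Set (K × K))} {H : Set (K × K)}
    {F G : MvPolynomial (Fin 3) K} :
    Tangent (insert H A) F G ↔ (eqn H).form ∣ (eqn H).act F G ∧ Tangent A F G :=
  Finset.forall_mem_insert _ _ _

open Classical in
theorem IsLineArr.insert {A : Finset (Set (K × K))} (hA : IsLineArr A) {H : Set (K × K)}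
    (hH : IsAffineLine H) : IsLineArr (insert H A) :=
  (Finset.forall_mem_insert _ _ _).mpr ⟨hH, hA⟩

open Classical in
theorem saitoFree_insert_of_dvd {A : Finset (Set (K × K))} {d₁ d₂ : ℕ} {H : Set (K × K)}
    (hHA : H ∉ A) {F₁ G₁ F₂ G₂ : MvPolynomial (Fin 3) K} (h1 : F₁.IsHomogeneous d₁)
    (h2 : G₁.IsHomogeneous d₁) (h3 : F₂.IsHomogeneous d₂) (h4 : G₂.IsHomogeneous d₂)
    (t1 : Tangent A F₁ G₁) (t2 : Tangent A F₂ G₂) {c : K} (hc : c ≠ 0)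
    (hdet : F₁ * G₂ - F₂ * G₁ = C c * defPoly A) (hdvd : (eqn H).form ∣ (eqn H).act F₁ G₁) :
    SaitoFree (insert H A) d₁ (d₂ + 1) := by
  have hf := (eqn H).form_homog
  rw [add_comm d₂]
  refine ⟨F₁, G₁, (eqn H).form * F₂, (eqn H).form * G₂, h1, h2, hf.mul h3, hf.mul h4,
    tangent_insert.mpr ⟨hdvd, t1⟩, tangent_insert.mpr ⟨?_, fun L hL => ?_⟩, c, hc, ?_⟩
  · exact ⟨(eqn H).act F₂ G₂, by simp only [LineEq.act]; ring⟩
  · obtain ⟨g, hg⟩ := t2 L hL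
    refine ⟨(eqn H).form * g, ?_⟩
    simp only [LineEq.act] at hg ⊢
    linear_combination (eqn H).form * hg
  · rw [defPoly, Finset.prod_insert hHA]
    change _ = C c * (_ * defPoly A)
    linear_combination (eqn H).form * hdet

open Classical in
/-- The addition theorem. -/
theorem SaitoFree.insert {A : Finset (Set (K × K))} {d₁ d₂ : ℕ} (h : SaitoFree A d₁ d₂)
    (hA : IsLineArr A) {H : Set (K × K)} (hH : IsAffineLine H) (hHA : H ∉ A)
    (hm : numMeets A H = d₁) : SaitoFree (insert H A) d₁ (d₂ + 1) := by
  have hcard := h.add_eq_card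
  obtain ⟨F₁, G₁, F₂, G₂, h1, h2, h3, h4, t1, t2, c, hc, hdet⟩ := h
  rw [numMeets] at hm
  set e := eqn H with he'
  have he : e.carrier ∉ A := by rwa [carrier_eqn hH]
  have hnd := e.not_form_dvd hA he hc
  rw [← hdet] at hnd
  obtain ⟨p₁, hp1, hp1d⟩ := e.exists_restr_act_eq hA he t1 h1 h2
  obtain ⟨p₂, hp2, hp2d⟩ := e.exists_restr_act_eq hA he t2 h3 h4
  by_cases p10 : p₁ = 0
  · rw [p10, mul_zero] at hp1
    exact saitoFree_insert_of_dvd hHA h1 h2 h3 h4 t1 t2 hc hdet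
      (e.form_dvd_act_of_restr h1 h2 hp1)
  have hd1 := hp1d p10
  by_cases p20 : p₂ = 0
  · rw [p20, mul_zero] at hp2
    rcases e.form_dvd_or_card_meets_le hA he t2 h3 h4 hp2 with ⟨h6, h7⟩ | h6
    · exact absurd (dvd_sub (h7.mul_left _) (h6.mul_right _)) hnd
    · obtain rfl : d₁ = d₂ := by omega
      refine saitoFree_insert_of_dvd hHA h3 h4 h1 h2 t2 t1 (neg_ne_zero.mpr hc) ?_
        (e.form_dvd_act_of_restr h3 h4 hp2)
      rw [C_neg]
      linear_combination -hdet
  have hd2 := hp2d p20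
  obtain ⟨c₂, rfl⟩ : ∃ c₂, p₂ = Polynomial.C c₂ :=
    ⟨_, Polynomial.eq_C_of_natDegree_eq_zero (by omega)⟩
  have hc2 : c₂ ≠ 0 := fun h => p20 (by rw [h, Polynomial.C_0])
  obtain ⟨E, hE, hEr⟩ := e.exists_restr_eq (p₁ * Polynomial.C c₂⁻¹) (d := d₁ - d₂)
    ((Polynomial.natDegree_mul_C_le _ _).trans (by omega))
  have hdeg : d₁ - d₂ + d₂ = d₁ := by omega
  have hE1 := hE.mul h3
  have hE2 := hE.mul h4
  rw [hdeg] at hE1 hE2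
  refine saitoFree_insert_of_dvd hHA (h1.sub hE1) (h2.sub hE2) h3 h4 (fun L hL => ?_) t2 hc
    (by linear_combination hdet) (e.form_dvd_act_of_restr (h1.sub hE1) (h2.sub hE2) ?_)
  · have : (eqn L).act (F₁ - E * F₂) (G₁ - E * G₂) =
        (eqn L).act F₁ G₁ - E * (eqn L).act F₂ G₂ := by
      simp only [LineEq.act]
      ring
    rw [this]
    exact dvd_sub (t1 L hL) ((t2 L hL).mul_left _)
  · have : e.act (F₁ - E * F₂) (G₁ - E * G₂) = e.act F₁ G₁ - E * e.act F₂ G₂ := by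
      simp only [LineEq.act]
      ring
    have hcc : Polynomial.C c₂⁻¹ * Polynomial.C c₂ = 1 := by
      rw [← Polynomial.C_mul, inv_mul_cancel₀ hc2, Polynomial.C_1]
    rw [this, map_sub, map_mul, hp1, hp2, hEr]
    linear_combination -(e.meetPoly A * p₁) * hcc

open Classical in
theorem b2_insert_s4 {A : Finset (Set (K × K))} (hA : IsLineArr A) {H : Set (K × K)}
    (hH : IsAffineLine H) (hHA : H ∉ A) : b2 (insert H A) = b2 A + numMeets A H := by
  set e := eqn H with he'
  have hce : e.carrier = H := carrier_eqn hH
  have he : e.carrier ∉ A := by rwa [hce]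
  have hset : A.powerset.filter (fun B => 2 ≤ (insert H B).card ∧
      (⋂ L ∈ insert H B, (L : Set (K × K))).Nonempty) =
      (e.meets A).biUnion fun t => (e.through A t).powerset.erase ∅ := by
    ext B
    simp only [Finset.mem_filter, Finset.mem_powerset, Finset.mem_biUnion, Finset.mem_erase]
    constructor
    · rintro ⟨hB, h2, q, hq⟩
      rw [Set.mem_iInter₂] at hq
      have hqH := hq H (Finset.mem_insert_self _ _)
      obtain ⟨t, rfl⟩ := e.exists_param_eq (hce ▸ hqH)
      rw [Finset.card_insert_of_notMem fun h => hHA (hB h)] at h2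
      obtain ⟨L, hL⟩ : B.Nonempty := Finset.card_pos.mp (by omega)
      refine ⟨t, (e.mem_meets_iff hA he t).mpr
        ⟨L, hB hL, hq L (Finset.mem_insert_of_mem hL)⟩, Finset.ne_empty_of_mem hL, fun L hL => ?_⟩
      exact (e.mem_through_iff hA he t L).mpr ⟨hB hL, hq L (Finset.mem_insert_of_mem hL)⟩
    · rintro ⟨t, -, hne, hB⟩
      have hB' := fun L hL => (e.mem_through_iff hA he t L).mp (hB hL)
      refine ⟨fun L hL => (hB' L hL).1, ?_, e.param t, ?_⟩
      · rw [Finset.card_insert_of_notMem fun h => hHA (hB' H h).1]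
        have := Finset.card_pos.mpr (Finset.nonempty_iff_ne_empty.mpr hne)
        omega
      · rw [Set.mem_iInter₂]
        intro L hL
        rcases Finset.mem_insert.mp hL with rfl | hL
        · exact hce ▸ e.param_mem t
        · exact (hB' L hL).2
  rw [b2, Finset.sum_filter, Finset.sum_powerset_insert hHA, ← Finset.sum_filter,
    ← Finset.sum_filter, hset]
  congr 1
  rw [Finset.sum_biUnion]
  · rw [numMeets, Finset.card_eq_sum_ones, Nat.cast_sum]
    refine Finset.sum_congr rfl fun t ht => ?_
    obtain ⟨L, hL, htL⟩ := (e.mem_meets_iff hA he t).mp ht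
    have hne : (e.through A t).Nonempty := ⟨L, (e.mem_through_iff hA he t L).mpr ⟨hL, htL⟩⟩
    have h1 := Finset.sum_powerset_neg_one_pow_card_of_nonempty hne
    rw [← Finset.add_sum_erase _ _ (Finset.empty_mem_powerset _)] at h1
    have h2 : ∀ B ∈ (e.through A t).powerset.erase ∅,
        (-1 : ℤ) ^ (insert H B).card = -(-1 : ℤ) ^ B.card := by
      intro B hB
      rw [Finset.card_insert_of_notMem fun h => hHA ((e.mem_through_iff hA he t H).mp
        (Finset.mem_powerset.mp (Finset.mem_of_mem_erase hB) h)).1, pow_succ]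
      ring
    rw [Finset.sum_congr rfl h2, Finset.sum_neg_distrib]
    simp only [Finset.card_empty, pow_zero] at h1
    push_cast
    linarith
  · intro s _ t _ hst
    refine Finset.disjoint_left.mpr fun B hBs hBt => hst ?_
    obtain ⟨hne, hs⟩ := Finset.mem_erase.mp hBs
    obtain ⟨L, hL⟩ := Finset.nonempty_iff_ne_empty.mpr hne
    have h1 := Finset.mem_powerset.mp hs hL
    have h2 := Finset.mem_powerset.mp (Finset.mem_of_mem_erase hBt) hL
    simp only [LineEq.through, Finset.mem_filter] at h1 h2
    exact h1.2.symm.trans h2.2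

theorem b2_empty : b2 (∅ : Finset (Set (K × K))) = 0 := by
  simp [b2, Finset.filter_singleton]

theorem mem_finsuppAntidiag_univ_iff (k : ℕ) (s : Fin 3 →₀ ℕ) :
    s ∈ Finset.univ.finsuppAntidiag k ↔ s.degree = k := by
  simp [Finset.mem_finsuppAntidiag, Finsupp.degree_eq_sum]

/-- The basis of monomials of the space of forms of degree `k`. -/
noncomputable def homogeneousBasis (k : ℕ) :
    Module.Basis {s : Fin 3 →₀ ℕ // s ∈ (Finset.univ : Finset (Fin 3)).finsuppAntidiag k} K
      (homogeneousSubmodule (Fin 3) K k) :=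
  .ofRepr ((LinearEquiv.ofEq _ _ (homogeneousSubmodule_eq_finsupp_supported (Fin 3) K k)).trans
    ((AddMonoidAlgebra.supportedEquivFinsupp _).trans
      (Finsupp.domLCongr
        (Equiv.subtypeEquivRight fun s => (mem_finsuppAntidiag_univ_iff k s).symm))))

instance finite_homogeneousSubmodule (k : ℕ) :
    Module.Finite K (homogeneousSubmodule (Fin 3) K k) :=
  .of_basis (homogeneousBasis k)

theorem two_mul_finrank_homogeneousSubmodule (k : ℕ) :
    2 * Module.finrank K (homogeneousSubmodule (Fin 3) K k) = (k + 1) * (k + 2) := by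
  rw [Module.finrank_eq_card_basis (homogeneousBasis k), Fintype.card_coe,
    Finset.card_finsuppAntidiag_nat_eq_choose]
  have h : (Finset.univ : Finset (Fin 3)).card + k - 1 = 2 + k := by
    rw [Finset.card_univ, Fintype.card_fin]
    omega
  rw [h, ← Nat.choose_symm_add, Nat.choose_two_right,
    Nat.two_mul_div_two_of_even (Nat.even_mul_pred_self _), mul_comm]
  congr 1 <;> omega

/-- The space of derivations of degree `k` tangent to the lines of `A`. -/
def tangentModule (A : Finset (Set (K × K))) (k : ℕ) :
    Submodule K (MvPolynomial (Fin 3) K × MvPolynomial (Fin 3) K) where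
  carrier := {θ | θ.1.IsHomogeneous k ∧ θ.2.IsHomogeneous k ∧ Tangent A θ.1 θ.2}
  add_mem' := by
    rintro ⟨F, G⟩ ⟨F', G'⟩ ⟨h1, h2, h3⟩ ⟨h4, h5, h6⟩
    refine ⟨h1.add h4, h2.add h5, fun L hL => ?_⟩
    have : (eqn L).act (F + F') (G + G') = (eqn L).act F G + (eqn L).act F' G' := by
      simp only [LineEq.act]
      ring
    exact this ▸ dvd_add (h3 L hL) (h6 L hL)
  zero_mem' := ⟨isHomogeneous_zero _ _ _, isHomogeneous_zero _ _ _, fun L _ => by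
    simp [LineEq.act]⟩
  smul_mem' := by
    rintro c ⟨F, G⟩ ⟨h1, h2, h3⟩
    refine ⟨(homogeneousSubmodule (Fin 3) K k).smul_mem c h1,
      (homogeneousSubmodule (Fin 3) K k).smul_mem c h2, fun L hL => ?_⟩
    have : (eqn L).act (c • F) (c • G) = C c * (eqn L).act F G := by
      simp only [LineEq.act, smul_eq_C_mul]
      ring
    exact this ▸ (h3 L hL).mul_left _

instance finite_tangentModule (A : Finset (Set (K × K))) (k : ℕ) :
    Module.Finite K (tangentModule A k) := by
  have h : ((homogeneousSubmodule (Fin 3) K k).prod (homogeneousSubmodule (Fin 3) K k)).FG :=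
    (Module.Finite.iff_fg.mp inferInstance).prod (Module.Finite.iff_fg.mp inferInstance)
  have := Module.Finite.iff_fg.mpr h
  exact Submodule.finiteDimensional_of_le
    (S₂ := (homogeneousSubmodule (Fin 3) K k).prod (homogeneousSubmodule (Fin 3) K k))
    fun θ hθ => ⟨hθ.1, hθ.2.1⟩

/-- The restriction to a line of the value on its equation, as a linear map. -/
noncomputable def LineEq.restrAct (e : LineEq K) :
    MvPolynomial (Fin 3) K × MvPolynomial (Fin 3) K →ₗ[K] Polynomial K where
  toFun θ := e.restr (e.act θ.1 θ.2)
  map_add' θ θ' := by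
    rw [← map_add]
    congr 1
    simp only [LineEq.act, Prod.fst_add, Prod.snd_add]
    ring
  map_smul' c θ := by
    rw [RingHom.id_apply, ← map_smul]
    congr 1
    simp only [LineEq.act, Prod.smul_fst, Prod.smul_snd, smul_eq_C_mul]
    ring

open Classical in
theorem finrank_tangentModule_le {A : Finset (Set (K × K))} (hA : IsLineArr A)
    {H : Set (K × K)} (hH : IsAffineLine H) (hHA : H ∉ A) {k : ℕ} (hk : A.card ≤ k) :
    Module.finrank K (tangentModule A k) + A.card ≤
      Module.finrank K (tangentModule (insert H A) k) + (k + numMeets A H + 1) := by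
  set e := eqn H with he'
  have he : e.carrier ∉ A := by rwa [carrier_eqn hH]
  let φ := e.restrAct.domRestrict (tangentModule A k)
  have h1 := φ.finrank_range_add_finrank_ker
  have h2 : Module.finrank K φ.ker ≤ Module.finrank K (tangentModule (insert H A) k) := by
    rw [← Submodule.finrank_map_subtype_eq]
    apply Submodule.finrank_mono
    rintro _ ⟨⟨θ, hθ⟩, hker, rfl⟩
    exact ⟨hθ.1, hθ.2.1, tangent_insert.mpr
      ⟨e.form_dvd_act_of_restr hθ.1 hθ.2.1 hker, hθ.2.2⟩⟩
  have h3 : Module.finrank K φ.range ≤ k + numMeets A H + 1 - A.card := by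
    have h4 : φ.range ≤ (Polynomial.degreeLT K (k + numMeets A H + 1 - A.card)).map
        (LinearMap.mulLeft K (e.meetPoly A)) := by
      rintro _ ⟨⟨θ, hθ⟩, rfl⟩
      obtain ⟨p, hp, hpd⟩ := e.exists_restr_act_eq hA he hθ.2.2 hθ.1 hθ.2.1
      refine ⟨p, ?_, hp.symm⟩
      by_cases hp0 : p = 0
      · exact hp0 ▸ Submodule.zero_mem _
      · have h5 := hpd hp0
        rw [SetLike.mem_coe, Polynomial.mem_degreeLT, ← Polynomial.natDegree_lt_iff_degree_lt hp0]
        have hm : numMeets A H = (e.meets A).card := rfl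
        omega
    calc Module.finrank K φ.range
        ≤ Module.finrank K ((Polynomial.degreeLT K (k + numMeets A H + 1 - A.card)).map
            (LinearMap.mulLeft K (e.meetPoly A))) := Submodule.finrank_mono h4
      _ ≤ Module.finrank K (Polynomial.degreeLT K (k + numMeets A H + 1 - A.card)) :=
          Submodule.finrank_map_le _ _
      _ = k + numMeets A H + 1 - A.card := by
          rw [Module.finrank_eq_card_basis (Polynomial.degreeLT.basis K _), Fintype.card_fin]
  omega

theorem SaitoFree.finrank_tangentModule {A : Finset (Set (K × K))} {d₁ d₂ : ℕ}
    (h : SaitoFree A d₁ d₂) (hA : IsLineArr A) {k : ℕ} (hk : A.card ≤ k) :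
    Module.finrank K (tangentModule A k) =
      Module.finrank K (homogeneousSubmodule (Fin 3) K (k - d₁)) +
      Module.finrank K (homogeneousSubmodule (Fin 3) K (k - d₂)) := by
  have hcard := h.add_eq_card
  obtain ⟨F₁, G₁, F₂, G₂, h1, h2, h3, h4, t1, t2, c, hc, hdet⟩ := h
  have hcC : C c * C c⁻¹ = (1 : MvPolynomial (Fin 3) K) := by
    rw [← C_mul, mul_inv_cancel₀ hc, C_1]
  have hQ : C c * defPoly A ≠ 0 := mul_ne_zero (C_ne_zero.mpr hc) (defPoly_ne_zero A)
  let Φ : homogeneousSubmodule (Fin 3) K (k - d₁) × homogeneousSubmodule (Fin 3) K (k - d₂) →ₗ[K]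
      MvPolynomial (Fin 3) K × MvPolynomial (Fin 3) K :=
    { toFun := fun x => (x.1.1 * F₁ + x.2.1 * F₂, x.1.1 * G₁ + x.2.1 * G₂)
      map_add' := fun x y => by
        refine Prod.ext ?_ ?_
        · simp
          ring
        · simp
          ring
      map_smul' := fun a x => by simp }
  have hinj : Function.Injective Φ := by
    rw [← LinearMap.ker_eq_bot, LinearMap.ker_eq_bot']
    rintro ⟨⟨p, hp⟩, ⟨q, hq⟩⟩ hpq
    have e0 : p * F₁ + q * F₂ = 0 := congrArg Prod.fst hpq
    have e1 : p * G₁ + q * G₂ = 0 := congrArg Prod.snd hpq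
    rw [← hdet] at hQ
    have hp0 : p = 0 := (mul_eq_zero.mp (show p * (F₁ * G₂ - F₂ * G₁) = 0 by
      linear_combination G₂ * e0 - F₂ * e1)).resolve_right hQ
    have hq0 : q = 0 := (mul_eq_zero.mp (show q * (F₁ * G₂ - F₂ * G₁) = 0 by
      linear_combination F₁ * e1 - G₁ * e0)).resolve_right hQ
    subst hp0 hq0
    rfl
  have hrange : Φ.range = tangentModule A k := by
    apply le_antisymm
    · rintro _ ⟨⟨⟨p, hp⟩, ⟨q, hq⟩⟩, rfl⟩
      have hp' : p.IsHomogeneous (k - d₁) := hp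
      have hq' : q.IsHomogeneous (k - d₂) := hq
      have k1 : k - d₁ + d₁ = k := by omega
      have k2 : k - d₂ + d₂ = k := by omega
      have hpF := hp'.mul h1
      have hpG := hp'.mul h2
      have hqF := hq'.mul h3
      have hqG := hq'.mul h4
      rw [k1] at hpF hpG
      rw [k2] at hqF hqG
      refine ⟨hpF.add hqF, hpG.add hqG, fun L hL => ?_⟩
      · have : (eqn L).act (p * F₁ + q * F₂) (p * G₁ + q * G₂) =
            p * (eqn L).act F₁ G₁ + q * (eqn L).act F₂ G₂ := by
          simp only [LineEq.act]
          ring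
        change (eqn L).form ∣ (eqn L).act (p * F₁ + q * F₂) (p * G₁ + q * G₂)
        rw [this]
        exact dvd_add ((t1 L hL).mul_left _) ((t2 L hL).mul_left _)
    · rintro ⟨F, G⟩ ⟨hF, hG, ht⟩
      obtain ⟨p, hp⟩ := ht.defPoly_dvd_det hA t2
      obtain ⟨q, hq⟩ := t1.defPoly_dvd_det hA ht
      have hp' : p.IsHomogeneous (k - d₁) := by
        apply (defPoly_homog A).of_mul_right (defPoly_ne_zero A)
        rw [mul_comm, ← hp, show k - d₁ + A.card = k + d₂ by omega]
        refine (hF.mul h4).sub ?_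
        rw [add_comm]
        exact h3.mul hG
      have hq' : q.IsHomogeneous (k - d₂) := by
        apply (defPoly_homog A).of_mul_right (defPoly_ne_zero A)
        rw [mul_comm, ← hq, show k - d₂ + A.card = d₁ + k by omega]
        refine (h1.mul hG).sub ?_
        rw [add_comm]
        exact hF.mul h2
      refine ⟨⟨⟨C c⁻¹ * p, hp'.C_mul _⟩, ⟨C c⁻¹ * q, hq'.C_mul _⟩⟩, Prod.ext ?_ ?_⟩
      · apply mul_left_cancel₀ hQ
        change C c * defPoly A * (C c⁻¹ * p * F₁ + C c⁻¹ * q * F₂) = C c * defPoly A * F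
        linear_combination (defPoly A * p * F₁ + defPoly A * q * F₂) * hcC
          - F₁ * hp - F₂ * hq + F * hdet
      · apply mul_left_cancel₀ hQ
        change C c * defPoly A * (C c⁻¹ * p * G₁ + C c⁻¹ * q * G₂) = C c * defPoly A * G
        linear_combination (defPoly A * p * G₁ + defPoly A * q * G₂) * hcC
          - G₁ * hp - G₂ * hq + G * hdet
  rw [← hrange, LinearMap.finrank_range_of_inj hinj, Module.finrank_prod]

/-- A quantity that increases with the arrangement, see `tangentIndex_mono`. -/
noncomputable def tangentIndex (A : Finset (Set (K × K))) (k : ℕ) : ℤ :=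
  2 * Module.finrank K (tangentModule A k) + (2 * k + 2) * A.card + 2 * b2 A
    - A.card * (A.card - 1)

open Classical in
theorem tangentIndex_insert {A : Finset (Set (K × K))} (hA : IsLineArr A)
    {H : Set (K × K)} (hH : IsAffineLine H) {k : ℕ} (hk : A.card ≤ k) :
    tangentIndex A k ≤ tangentIndex (insert H A) k := by
  by_cases hHA : H ∈ A
  · rw [Finset.insert_eq_of_mem hHA]
  have h1 := finrank_tangentModule_le hA hH hHA hk
  have h2 := b2_insert_s4 hA hH hHA
  zify at h1
  rw [tangentIndex, tangentIndex, h2, Finset.card_insert_of_notMem hHA]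
  push_cast
  linarith

theorem tangentIndex_mono {A A' : Finset (Set (K × K))} (hA' : IsLineArr A') (h : A ⊆ A') {k : ℕ}
    (hk : A'.card ≤ k) : tangentIndex A k ≤ tangentIndex A' k := by
  classical
  suffices ∀ T : Finset (Set (K × K)), T ⊆ A' → tangentIndex A k ≤ tangentIndex (T ∪ A) k by
    simpa [Finset.union_eq_left.mpr h] using this A' subset_rfl
  intro T
  induction T using Finset.induction_on with
  | empty => simp
  | insert H T _ ih =>
    intro hT
    have hTA : T ∪ A ⊆ A' :=
      Finset.union_subset ((Finset.subset_insert _ _).trans hT) h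
    rw [Finset.insert_union]
    exact (ih ((Finset.subset_insert _ _).trans hT)).trans
      (tangentIndex_insert (hA'.subset hTA) (hA' H (hT (Finset.mem_insert_self _ _)))
        ((Finset.card_le_card hTA).trans hk))

theorem SaitoFree.tangentIndex_eq {A : Finset (Set (K × K))} {d₁ d₂ : ℕ}
    (h : SaitoFree A d₁ d₂) (hA : IsLineArr A) {k : ℕ} (hk : A.card ≤ k) :
    tangentIndex A k = 2 * (k + 1) * (k + 2) + 2 * (b2 A - d₁ * d₂) := by
  have hcard := h.add_eq_card
  have h1 := two_mul_finrank_homogeneousSubmodule (K := K) (k - d₁)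
  have h2 := two_mul_finrank_homogeneousSubmodule (K := K) (k - d₂)
  rw [tangentIndex, h.finrank_tangentModule hA hk]
  zify [show d₁ ≤ k by omega] at h1
  zify [show d₂ ≤ k by omega] at h2
  have h3 : (A.card : ℤ) = d₁ + d₂ := by rw [← hcard]; push_cast; ring
  rw [h3]
  push_cast
  linear_combination h1 + h2

theorem saitoFree_empty : SaitoFree (∅ : Finset (Set (K × K))) 0 0 := by
  refine ⟨1, 0, 0, 1, isHomogeneous_one _ _, isHomogeneous_zero _ _ _, isHomogeneous_zero _ _ _,
    isHomogeneous_one _ _, ?_, ?_, 1, one_ne_zero, by simp [defPoly]⟩ <;>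
  exact fun L hL => absurd hL (Finset.notMem_empty L)

theorem SaitoFree.mul_le_b2 {A : Finset (Set (K × K))} {d₁ d₂ : ℕ} (h : SaitoFree A d₁ d₂)
    (hA : IsLineArr A) : (d₁ * d₂ : ℤ) ≤ b2 A := by
  have h1 := tangentIndex_mono hA (Finset.empty_subset A) le_rfl
  rw [saitoFree_empty.tangentIndex_eq (hA.subset (Finset.empty_subset A)) (Nat.zero_le _),
    h.tangentIndex_eq hA le_rfl, b2_empty] at h1
  push_cast at h1
  linarith

theorem SaitoFree.b2_sub_mul_le {A A' : Finset (Set (K × K))} {d₁ d₂ e₁ e₂ : ℕ}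
    (h : SaitoFree A d₁ d₂) (h' : SaitoFree A' e₁ e₂) (hA' : IsLineArr A') (hAA' : A ⊆ A') :
    b2 A - d₁ * d₂ ≤ b2 A' - e₁ * e₂ := by
  have h1 := tangentIndex_mono hA' hAA' le_rfl
  rw [h.tangentIndex_eq (hA'.subset hAA') (Finset.card_le_card hAA'),
    h'.tangentIndex_eq hA' le_rfl] at h1
  linarith

theorem numMeets_eq_card {A V : Finset (Set (K × K))} (hA : IsLineArr A) {H : Set (K × K)}
    (hH : IsAffineLine H) (hHA : H ∉ A) (hVA : V ⊆ A)
    (hmeet : ∀ L ∈ V, ∃ q ∈ H, q ∈ L)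
    (hdisj : ∀ L ∈ V, ∀ L' ∈ V, ∀ q, q ∈ L → q ∈ L' → L = L')
    (hcover : ∀ L ∈ A, ∀ q ∈ H, q ∈ L → ∃ L' ∈ V, q ∈ L') : numMeets A H = V.card := by
  have he : (eqn H).carrier ∉ A := by rwa [carrier_eqn hH]
  have hcr : ∀ L ∈ A, ∀ t, (eqn H).param t ∈ L → (eqn H).meetPar L = t := by
    intro L hL t ht
    exact ((eqn H).meetPar_eq_iff (hA L hL) ((eqn H).cross_ne_zero_of_param_mem (hA L hL)
      (fun h => he (h ▸ hL)) ht) t).mpr ht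
  have hpar : ∀ L ∈ V, (eqn H).param ((eqn H).meetPar L) ∈ L := by
    intro L hL
    obtain ⟨q, hq, hqL⟩ := hmeet L hL
    rw [← carrier_eqn hH] at hq
    obtain ⟨t, rfl⟩ := (eqn H).exists_param_eq hq
    rwa [hcr L (hVA hL) t hqL]
  symm
  refine Finset.card_bij (fun L _ => (eqn H).meetPar L) (fun L hL => ?_) (fun L hL L' hL' h => ?_)
    fun t ht => ?_
  · exact ((eqn H).mem_meets_iff hA he _).mpr ⟨L, hVA hL, hpar L hL⟩
  · have h' : (eqn H).meetPar L = (eqn H).meetPar L' := h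
    exact hdisj L hL L' hL' _ (hpar L hL) (h' ▸ hpar L' hL')
  · obtain ⟨L, hL, htL⟩ := ((eqn H).mem_meets_iff hA he t).mp ht
    obtain ⟨L', hL', htL'⟩ := hcover L hL _
      ((carrier_eqn hH).subset ((eqn H).param_mem t)) htL
    exact ⟨L', hL', hcr L' (hVA hL') t htL'⟩

/-- The vertical line with a given abscissa. -/
def vertLine (x : K) : Set (K × K) := {p | p.1 = x}

theorem isAffineLine_vertLine (x : K) : IsAffineLine (vertLine x) := by
  refine ⟨1, 0, -x, by simp, ?_⟩
  ext p
  simp [vertLine, ← sub_eq_add_neg, sub_eq_zero]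

theorem vertLine_or_surj {L : Set (K × K)} (hL : IsAffineLine L) :
    (∃ x, L = vertLine x) ∨ ∀ x, ∃ y, (x, y) ∈ L := by
  obtain ⟨a, b, c, h, rfl⟩ := hL
  by_cases hb : b = 0
  · left
    have ha : a ≠ 0 := fun ha => h (by rw [ha, hb])
    refine ⟨-c / a, ?_⟩
    ext p
    simp only [vertLine, Set.mem_ofPred_eq, hb, eq_div_iff ha]
    constructor <;> intro h1 <;> linear_combination h1
  · right
    intro x
    refine ⟨(-(a * x) - c) / b, ?_⟩
    simp only [Set.mem_ofPred_eq, mul_div_cancel₀ _ hb]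
    ring

theorem saitoFree_vertLines (V : Finset (Set (K × K))) (hV : ∀ L ∈ V, ∃ x, L = vertLine x) :
    SaitoFree V 0 V.card ∧ b2 V = 0 := by
  classical
  induction V using Finset.induction_on with
  | empty => exact ⟨saitoFree_empty, b2_empty⟩
  | insert H V hHV ih =>
    rw [Finset.forall_mem_insert] at hV
    obtain ⟨⟨x, rfl⟩, hV⟩ := hV
    obtain ⟨h1, h2⟩ := ih hV
    have hVarr : IsLineArr V := fun L hL => by
      obtain ⟨y, rfl⟩ := hV L hL
      exact isAffineLine_vertLine y
    have hm : numMeets V (vertLine x) = 0 := by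
      refine numMeets_eq_card (V := ∅) hVarr (isAffineLine_vertLine x) hHV (Finset.empty_subset _)
        (by simp) (by simp) fun L hL q hq hqL => ?_
      obtain ⟨y, rfl⟩ := hV L hL
      have hq' : q.1 = x := hq
      have hqy : q.1 = y := hqL
      exact absurd hL (hqy.symm.trans hq' ▸ hHV)
    rw [Finset.card_insert_of_notMem hHV, b2_insert_s4 hVarr (isAffineLine_vertLine x) hHV, hm, h2]
    exact ⟨h1.insert hVarr (isAffineLine_vertLine x) hHV hm, by simp⟩

/-- Every line arrangement is contained in a supersolvable one. -/
theorem exists_saitoFree_superset {A : Finset (Set (K × K))} (hA : IsLineArr A) :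
    ∃ A' : Finset (Set (K × K)), A ⊆ A' ∧ IsLineArr A' ∧
      ∃ v w : ℕ, SaitoFree A' v w ∧ b2 A' = v * w := by
  classical
  set N := A.filter fun L => ∀ x, ∃ y, (x, y) ∈ L with hN
  set V := (A.filter fun L => ∃ x, L = vertLine x) ∪ (N.biUnion fun H =>
    ((eqn H).meets (N.erase H)).image fun t => vertLine ((eqn H).param t).1) with hVdef
  have hV : ∀ L ∈ V, ∃ x, L = vertLine x := by
    intro L hL
    rcases Finset.mem_union.mp hL with h | h
    · exact (Finset.mem_filter.mp h).2
    · obtain ⟨H, -, h⟩ := Finset.mem_biUnion.mp h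
      obtain ⟨t, -, rfl⟩ := Finset.mem_image.mp h
      exact ⟨_, rfl⟩
  have hVarr : IsLineArr V := fun L hL => by
    obtain ⟨y, rfl⟩ := hV L hL
    exact isAffineLine_vertLine y
  have hNA : N ⊆ A := Finset.filter_subset _ _
  have hNarr := hA.subset hNA
  have hmem : ∀ H ∈ N, ∀ L ∈ N, L ≠ H → ∀ q ∈ H, q ∈ L → vertLine q.1 ∈ V := by
    intro H hH L hL hLH q hqH hqL
    have hce := carrier_eqn (hNarr H hH)
    rw [← hce] at hqH
    obtain ⟨t, rfl⟩ := (eqn H).exists_param_eq hqH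
    refine Finset.mem_union_right _ (Finset.mem_biUnion.mpr ⟨H, hH, Finset.mem_image.mpr
      ⟨t, ((eqn H).mem_meets_iff (hNarr.subset (N.erase_subset H)) ?_ t).mpr
        ⟨L, Finset.mem_erase.mpr ⟨hLH, hL⟩, hqL⟩, rfl⟩⟩)
    rw [hce]
    exact Finset.notMem_erase H N
  have harr : ∀ T ⊆ N, IsLineArr (T ∪ V) := fun T hT L hL =>
    (Finset.mem_union.mp hL).elim (fun h => hNarr L (hT h)) (hVarr L)
  have hmain : ∀ T : Finset (Set (K × K)), T ⊆ N →
      SaitoFree (T ∪ V) V.card T.card ∧ b2 (T ∪ V) = V.card * T.card := by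
    intro T
    induction T using Finset.induction_on with
    | empty =>
      intro _
      obtain ⟨h1, h2⟩ := saitoFree_vertLines V hV
      rw [Finset.empty_union]
      exact ⟨h1.symm, by simp [h2]⟩
    | insert H T hHT ih =>
      intro hT
      have hHN := hT (Finset.mem_insert_self H T)
      have hTN := (Finset.subset_insert H T).trans hT
      obtain ⟨h1, h2⟩ := ih hTN
      have hsurj := (Finset.mem_filter.mp hHN).2
      have hHTV : H ∉ T ∪ V := by
        intro h
        obtain ⟨x, rfl⟩ := hV H ((Finset.mem_union.mp h).resolve_left hHT)
        obtain ⟨y, hy⟩ := hsurj (x + 1)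
        have hy' : x + 1 = x := hy
        simp at hy'
      have hm : numMeets (T ∪ V) H = V.card := by
        refine numMeets_eq_card (harr T hTN) (hNarr H hHN) hHTV Finset.subset_union_right
          (fun L hL => ?_) (fun L hL L' hL' q hq hq' => ?_) fun L hL q hq hqL => ?_
        · obtain ⟨x, rfl⟩ := hV L hL
          obtain ⟨y, hy⟩ := hsurj x
          exact ⟨_, hy, rfl⟩
        · obtain ⟨x, rfl⟩ := hV L hL
          obtain ⟨x', rfl⟩ := hV L' hL'
          have h3 : q.1 = x := hq
          have h4 : q.1 = x' := hq'
          rw [← h3, ← h4]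
        · rcases Finset.mem_union.mp hL with h | h
          · exact ⟨_, hmem H hHN L (hTN h) (fun h' => hHT (h' ▸ h)) q hq hqL, rfl⟩
          · exact ⟨L, h, hqL⟩
      rw [Finset.insert_union, Finset.card_insert_of_notMem hHT,
        b2_insert_s4 (harr T hTN) (hNarr H hHN) hHTV, hm, h2]
      refine ⟨h1.insert (harr T hTN) (hNarr H hHN) hHTV hm, ?_⟩
      push_cast
      ring
  refine ⟨N ∪ V, fun L hL => ?_, harr N subset_rfl, V.card, N.card, hmain N subset_rfl⟩
  rcases vertLine_or_surj (hA L hL) with h | h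
  · exact Finset.mem_union_right _ (Finset.mem_union_left _ (Finset.mem_filter.mpr ⟨hL, h⟩))
  · exact Finset.mem_union_left _ (Finset.mem_filter.mpr ⟨hL, h⟩)

/-- The factorization of the characteristic polynomial of a free arrangement. -/
theorem SaitoFree.b2_eq {A : Finset (Set (K × K))} {d₁ d₂ : ℕ} (h : SaitoFree A d₁ d₂)
    (hA : IsLineArr A) : b2 A = d₁ * d₂ := by
  obtain ⟨A', hAA', hA', v, w, h', hb⟩ := exists_saitoFree_superset hA
  have h1 := h.mul_le_b2 hA
  have h2 := h.b2_sub_mul_le h' hA' hAA'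
  rw [hb] at h2
  linarith

theorem numMeets_mono {C A : Finset (Set (K × K))} (h : C ⊆ A) (H : Set (K × K)) :
    numMeets C H ≤ numMeets A H := (eqn H).card_meets_mono h

theorem add_mul_le_b2 {A C : Finset (Set (K × K))} (hA : IsLineArr A) (hCA : C ⊆ A) {m N : ℕ}
    (hN : C.card + N = A.card) (hm : ∀ H ∈ A, H ∉ C → m ≤ numMeets C H) :
    b2 C + N * m ≤ b2 A := by
  classical
  induction N generalizing C with
  | zero =>
    rw [Finset.eq_of_subset_of_card_le hCA (by omega)]
    simp
  | succ N ih =>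
    obtain ⟨H, hHA, hHC⟩ := Finset.exists_mem_notMem_of_card_lt_card (s := C) (t := A) (by omega)
    have h1 := ih (C := insert H C) (Finset.insert_subset hHA hCA)
      (by rw [Finset.card_insert_of_notMem hHC]; omega) fun L hL hLC =>
        (hm L hL fun h => hLC (Finset.mem_insert_of_mem h)).trans
          (numMeets_mono (Finset.subset_insert H C) L)
    rw [b2_insert_s4 (hA.subset hCA) (hA H hHA) hHC] at h1
    have h2 : (m : ℤ) ≤ numMeets C H := by exact_mod_cast hm H hHA hHC
    push_cast
    linarith

theorem SaitoFree.extend {A C : Finset (Set (K × K))} {d e : ℕ} (h : SaitoFree C d e)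
    (hA : IsLineArr A) (hCA : C ⊆ A) {N : ℕ} (hN : C.card + N = A.card)
    (hm : ∀ H ∈ A, H ∉ C → d ≤ numMeets C H) (hb : b2 A ≤ b2 C + N * d) :
    SaitoFree A d (e + N) := by
  classical
  induction N generalizing C e with
  | zero => rwa [← Finset.eq_of_subset_of_card_le hCA (by omega)]
  | succ N ih =>
    obtain ⟨H, hHA, hHC⟩ := Finset.exists_mem_notMem_of_card_lt_card (s := C) (t := A) (by omega)
    have hsub := Finset.insert_subset hHA hCA
    have hcard : (Insert.insert H C).card + N = A.card := by
      rw [Finset.card_insert_of_notMem hHC]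
      omega
    have hm' : ∀ L ∈ A, L ∉ Insert.insert H C → d ≤ numMeets (Insert.insert H C) L :=
      fun L hL hLC => (hm L hL fun h => hLC (Finset.mem_insert_of_mem h)).trans
        (numMeets_mono (Finset.subset_insert H C) L)
    have h1 := add_mul_le_b2 hA hsub hcard hm'
    have h2 := b2_insert_s4 (hA.subset hCA) (hA H hHA) hHC
    have h3 := hm H hHA hHC
    have h4 : numMeets C H = d := by
      zify at h3 ⊢
      push_cast at hb
      linarith
    rw [h4] at h2
    have := ih (h.insert (hA.subset hCA) (hA H hHA) hHC h4) hsub hcard hm' (by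
      rw [h2]
      push_cast at hb
      linarith)
    rwa [show e + 1 + N = e + (N + 1) by omega] at this

theorem SaitoFree.exists_maximal {A B : Finset (Set (K × K))} {d e : ℕ} (h : SaitoFree B d e)
    (hA : IsLineArr A) (hBA : B ⊆ A) :
    ∃ (C : Finset (Set (K × K))) (u : ℕ), B ⊆ C ∧ C ⊆ A ∧ SaitoFree C d (e + u) ∧
      ∀ H ∈ A, H ∉ C → numMeets C H ≠ d := by
  classical
  obtain ⟨N, hN⟩ := Nat.exists_eq_add_of_le (Finset.card_le_card hBA)
  induction N generalizing B e with
  | zero =>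
    have hBA' := Finset.eq_of_subset_of_card_le hBA (by omega)
    exact ⟨B, 0, subset_rfl, hBA, h, fun H hH hHB => absurd (hBA' ▸ hH) hHB⟩
  | succ N ih =>
    by_cases hex : ∃ H ∈ A, H ∉ B ∧ numMeets B H = d
    · obtain ⟨H, hHA, hHB, hd⟩ := hex
      obtain ⟨C, u, h1, h2, h3, h4⟩ := ih (h.insert (hA.subset hBA) (hA H hHA) hHB hd)
        (Finset.insert_subset hHA hBA) (by rw [Finset.card_insert_of_notMem hHB]; omega)
      refine ⟨C, u + 1, (Finset.subset_insert H B).trans h1, h2, ?_, h4⟩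
      rwa [show e + (u + 1) = e + 1 + u by omega]
    · push Not at hex
      exact ⟨B, 0, subset_rfl, hBA, h, hex⟩

/-- A subarrangement of a free arrangement with given exponents cannot have exponents that are
too far apart. -/
theorem SaitoFree.card_le_of_subset {A C : Finset (Set (K × K))} {d e d₁ d₂ m : ℕ}
    (hC : SaitoFree C d e) (hA : IsLineArr A) (h : SaitoFree A d₁ d₂) (hCA : C ⊆ A)
    (h1m : d₁ ≤ m) (h2m : d₂ ≤ m) : e ≤ m := by
  by_contra! hlt
  have hcard := hC.add_eq_card
  obtain ⟨F, G, F', G', k1, k2, k3, k4, t, t', c', hc', hdet'⟩ := hC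
  obtain ⟨P, P', R, R', m1, m2, m3, m4, tP, tR, c, hc, hdet⟩ := h
  have hzero : ∀ {k : ℕ} {S S' : MvPolynomial (Fin 3) K}, S.IsHomogeneous k →
      S'.IsHomogeneous k → Tangent A S S' → k ≤ m → F * S' - S * G = 0 := by
    intro k S S' hS hS' tS hk
    have hh : (F * S' - S * G).IsHomogeneous (d + k) := by
      refine (k1.mul hS').sub ?_
      rw [add_comm]
      exact hS.mul k2
    exact hh.eq_zero_of_dvd (defPoly_homog C)
      (t.defPoly_dvd_det (hA.subset hCA) (tS.subset hCA)) (by omega)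
  have e1 := hzero m1 m2 tP h1m
  have e2 := hzero m3 m4 tR h2m
  have hQ : P * R' - R * P' ≠ 0 := by
    rw [hdet]
    exact mul_ne_zero (C_ne_zero.mpr hc) (defPoly_ne_zero A)
  have hF : F = 0 := (mul_eq_zero.mp (show F * (P * R' - R * P') = 0 by
    linear_combination P * e2 - R * e1)).resolve_right hQ
  have hG : G = 0 := (mul_eq_zero.mp (show G * (P * R' - R * P') = 0 by
    linear_combination P' * e2 - R' * e1)).resolve_right hQ
  rw [hF, hG, zero_mul, mul_zero, sub_zero, eq_comm] at hdet'
  exact mul_ne_zero (C_ne_zero.mpr hc') (defPoly_ne_zero C) hdet'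

theorem SaitoFree.isFree {A : Finset (Set (K × K))} {d₁ d₂ : ℕ} (h : SaitoFree A d₁ d₂)
    (hA : IsLineArr A) : IsFree A := ⟨d₁, d₂, h.isFreeExp hA⟩

theorem card_b2_of_chi {k : Type*} {A : Finset (Set (k × k))} {x y : ℤ}
    (h : ∀ t : ℂ, chi A t = (t - x) * (t - y)) : (A.card : ℤ) = x + y ∧ b2 A = x * y := by
  have h0 := h 0
  have h1 := h 1
  simp only [chi] at h0 h1
  have hb : (b2 A : ℂ) = x * y := by linear_combination h0
  have hc : (A.card : ℂ) = x + y := by linear_combination h0 - h1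
  exact ⟨by exact_mod_cast hc, by exact_mod_cast hb⟩

theorem SaitoFree.chi_eq {A : Finset (Set (K × K))} {d₁ d₂ : ℕ} (h : SaitoFree A d₁ d₂)
    (hA : IsLineArr A) (t : ℂ) : chi A t = (t - d₁) * (t - d₂) := by
  rw [chi, h.b2_eq hA, ← h.add_eq_card]
  push_cast
  ring

theorem not_exists_intermediate {A B : Finset (Set (K × K))} (hA : IsLineArr A) {n r s p q : ℕ}
    (hcard : A.card = 2 * n + r) (hb2 : b2 A = n * (n + r)) (hBA : B ⊆ A) (hs : 1 ≤ s)
    (hp : p + s = n) (hq : q + 1 = n) (hB : SaitoFree B p q) (hfree : IsFree A)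
    {C : Finset (Set (K × K))} {u : ℤ} (hBC : B ⊆ C) (hCA : C ⊆ A) (hu : (r : ℤ) + 1 < u)
    (hchi : ∀ t : ℂ, chi C t = (t - n - u + 1) * (t - n + s)) : False := by
  obtain ⟨d₁, d₂, hd⟩ := hfree
  have hd := hd.saitoFree hA
  have hsum := hd.add_eq_card
  have hprod := hd.b2_eq hA
  lift u to ℕ using by omega
  obtain ⟨hCc, hCb⟩ := card_b2_of_chi (A := C) (x := n + u - 1) (y := n - s) fun t => by
    rw [hchi]
    push_cast
    ring
  have hBc := hB.add_eq_card
  have hBb := hB.b2_eq (hA.subset hBA)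
  have hC : SaitoFree C p (q + u) := by
    refine hB.extend (hA.subset hCA) hBC (by omega) (fun H hH hHB => ?_) ?_
    · by_contra hlt
      have := hB.le_numMeets (hA.subset hBA) (hA H (hCA hH)) hHB (by omega)
      omega
    · rw [hCb, hBb, show (n : ℤ) - s = p by omega, show (n : ℤ) + u - 1 = q + u by omega]
      exact le_of_eq (by ring)
  have hroot : ((d₁ : ℤ) - n) * (d₁ - n - r) = 0 := by
    have h1 : (d₁ : ℤ) + d₂ = 2 * n + r := by omega
    rw [hprod] at hb2
    linear_combination (d₁ : ℤ) * h1 - hb2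
  have := hC.card_le_of_subset hA hd hCA (m := n + r)
    (by rcases mul_eq_zero.mp hroot with h | h <;> omega)
    (by rcases mul_eq_zero.mp hroot with h | h <;> omega)
  omega

theorem isFree_of_not_exists_intermediate {A B : Finset (Set (K × K))} (hA : IsLineArr A)
    {n r s p q : ℕ} (hcard : A.card = 2 * n + r) (hb2 : b2 A = n * (n + r)) (hBA : B ⊆ A)
    (hp : p + s = n) (hq : q + 1 = n) (hB : SaitoFree B p q)
    (hno : ∀ (C : Finset (Set (K × K))) (u : ℕ), B ⊆ C → C ⊆ A → SaitoFree C p (q + u) →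
      u ≤ r + 1) : IsFree A := by
  obtain ⟨C, u, hBC, hCA, hC, hmax⟩ := hB.exists_maximal hA hBA
  have hu := hno C u hBC hCA hC
  have hCc := hC.add_eq_card
  have hCb := hC.b2_eq (hA.subset hCA)
  have hm : ∀ H ∈ A, H ∉ C → q + u ≤ numMeets C H := fun H hH hHC =>
    hC.le_numMeets (hA.subset hCA) (hA H hH) hHC (hmax H hH hHC)
  have hle := Finset.card_le_card hCA
  obtain ⟨N, hN⟩ := Nat.exists_eq_add_of_le hle
  have hNz : (N : ℤ) = r + 1 + s - u := by omega
  have hnz : (n : ℤ) = q + 1 := by omega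
  have hpz : (p : ℤ) = q + 1 - s := by omega
  rcases Nat.eq_zero_or_pos u with rfl | hu0
  · obtain ⟨C', j, hCC', hC'A, hC', hmax'⟩ := hC.symm.exists_maximal hA hCA
    have hCc' := hC'.add_eq_card
    have hCb' := hC'.b2_eq (hA.subset hC'A)
    have hm' : ∀ H ∈ A, H ∉ C' → p + j ≤ numMeets C' H := fun H hH hHC =>
      hC'.le_numMeets (hA.subset hC'A) (hA H hH) hHC (hmax' H hH hHC)
    have hm'' : ∀ H ∈ A, H ∉ C' → n ≤ numMeets C' H := fun H hH hHC => by
      have h1 := hmax' H hH hHC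
      have h2 := hm H hH fun h => hHC (hCC' h)
      have h3 := numMeets_mono hCC' H
      omega
    have hle' := Finset.card_le_card hC'A
    obtain ⟨M, hM⟩ := Nat.exists_eq_add_of_le hle'
    have hMz : (M : ℤ) = r + 1 + s - j := by omega
    have hcount := add_mul_le_b2 hA hC'A hM.symm hm''
    have hcount' := add_mul_le_b2 hA hC'A hM.symm hm'
    rw [hCb', hb2] at hcount hcount'
    push_cast at hcount hcount'
    rw [hMz, hnz, hpz] at hcount hcount'
    have hjs : (s : ℤ) ≤ j := by linarith
    obtain ⟨i, rfl⟩ := Nat.exists_eq_add_of_le (show s ≤ j by omega)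
    push_cast at hcount' hMz
    have hir : (i : ℤ) * (r - i) ≤ 0 := by linarith
    have hi : i = 0 ∨ i = r ∨ i = r + 1 := by
      rcases Nat.eq_zero_or_pos i with h | h
      · exact .inl h
      · have : (r : ℤ) - i ≤ 0 := by
          by_contra! h2
          have : 0 < (i : ℤ) * (r - i) := mul_pos (by omega) h2
          linarith
        omega
    rcases hi with rfl | rfl | rfl
    · refine (hC'.symm.extend hA hC'A hM.symm hm' ?_).isFree hA
      rw [hCb', hb2, hMz]
      push_cast
      rw [hpz, hnz]
      exact le_of_eq (by ring)
    · refine (hC'.symm.extend hA hC'A hM.symm hm' ?_).isFree hA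
      rw [hCb', hb2, hMz]
      push_cast
      rw [hpz, hnz]
      exact le_of_eq (by ring)
    · rw [← Finset.eq_of_subset_of_card_le hC'A (by omega)]
      exact hC'.isFree (hA.subset hC'A)
  · have hcount := add_mul_le_b2 hA hCA hN.symm hm
    rw [hCb, hb2] at hcount
    push_cast at hcount
    rw [hNz, hnz, hpz] at hcount
    have hur : ((u : ℤ) - 1) * (r + 1 - u) ≤ 0 := by linarith
    have hu1 : u = 1 ∨ u = r + 1 := by
      by_contra! h
      have : 0 < ((u : ℤ) - 1) * (r + 1 - u) := mul_pos (by omega) (by omega)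
      linarith
    refine (hC.symm.extend hA hCA hN.symm hm ?_).isFree hA
    rw [hCb, hb2, hNz]
    push_cast
    rw [hpz, hnz]
    rcases hu1 with rfl | rfl
    · push_cast
      exact le_of_eq (by ring)
    · push_cast
      exact le_of_eq (by ring)

/-- **Theorem 1.4** (generalized Faenzi–Vallès theorem). Let `|A| = 2n + r`,
`χ(A,t) = (t−n)(t−n−r)`, and assume `A` contains a free subarrangement `B` with
`exp₀(B) = (n−s, n−1)`, `s ≥ 1`. Then `A` is free iff there is no `B ⊆ C ⊆ A`
with `χ(C,t) = (t−n−u+1)(t−n+s)` for some `u > r + 1`. -/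
theorem free_iff_no_intermediate_arrangement
    {K : Type*} [Field K] (A : Finset (Set (K × K))) (hA : IsLineArr A)
    (n r : ℕ) (hcard : A.card = 2 * n + r)
    (hchi : ∀ t : ℂ, chi A t = (t - (n : ℂ)) * (t - (n : ℂ) - (r : ℂ)))
    (B : Finset (Set (K × K))) (hBA : B ⊆ A)
    (s : ℕ) (hs : 1 ≤ s)
    (hBfree : IsFreeExpZ B ((n : ℤ) - (s : ℤ)) ((n : ℤ) - 1)) :
    IsFree A ↔
      ¬ ∃ (Carr : Finset (Set (K × K))) (u : ℤ), B ⊆ Carr ∧ Carr ⊆ A ∧ (r : ℤ) + 1 < u ∧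
        ∀ t : ℂ, chi Carr t = (t - (n : ℂ) - (u : ℂ) + 1) * (t - (n : ℂ) + (s : ℂ)) := by
  obtain ⟨p, q, hp, hq, hB⟩ := hBfree
  have hB := hB.saitoFree (hA.subset hBA)
  have hb2 : b2 A = n * (n + r) :=
    (card_b2_of_chi (x := n) (y := n + r) fun t => by
      rw [hchi]
      push_cast
      ring).2
  constructor
  · rintro hfree ⟨C, u, hBC, hCA, hu, hC⟩
    exact not_exists_intermediate hA hcard hb2 hBA hs (by omega) (by omega) hB hfree hBC hCA hu hC
  · intro hno
    refine isFree_of_not_exists_intermediate hA hcard hb2 hBA (p := p) (q := q) (s := s)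
      (by omega) (by omega) hB fun C u hBC hCA hC => ?_
    by_contra hlt
    refine hno ⟨C, u, hBC, hCA, by omega, fun t => ?_⟩
    have hpC : (p : ℂ) = n - s := by exact_mod_cast congrArg (Int.cast (R := ℂ)) hp
    have hqC : (q : ℂ) = n - 1 := by exact_mod_cast congrArg (Int.cast (R := ℂ)) hq
    rw [hC.chi_eq (hA.subset hCA)]
    push_cast
    rw [hpC, hqC]
    ring
end
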